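/- arXiv:1707.00412 — 3 statements merged into one kernel-verified Lean document; each statement's English description precedes it below -/
import Mathlib

section
/- Fix c ∈ {1, 4, 8}, exponents μ, α, β ∈ {0,1} with μ + α + β ≤ 1, and residues ε₁, ε₂, ε₃ ∈ {1, 3} modulo 4. Let T(X) be the number of triples (m₁, m₂, m₃) of positive odd integers such that m₁m₂m₃ is squarefree, mᵢ ≡ εᵢ (mod 4) for i = 1,2,3, and c·2^{μ+α+β}·m₁m₂m₃ ≤ √X. Then T(X) = (√X·(log X)²)/(160·c·2^{μ+α+β}) · ∏_p (1 − 1/p)³(1 + 3/p) + O(√X·log X), where the product runs over all primes p. -/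
open Finset ArithmeticFunction

/-- The Bell series of an arithmetic function at `p`. -/
noncomputable def bellSeries (p : ℕ) (f : ArithmeticFunction ℝ) : PowerSeries ℝ :=
  PowerSeries.mk fun k => f (p ^ k)

theorem bellSeries_mul {p : ℕ} (hp : p.Prime) (f g : ArithmeticFunction ℝ) :
    bellSeries p (f * g) = bellSeries p f * bellSeries p g := by
  ext k
  simp only [bellSeries, PowerSeries.coeff_mk, PowerSeries.coeff_mul, mul_apply]
  rw [Nat.sum_divisorsAntidiagonal (fun a b => f a * g b), Nat.sum_divisors_prime_pow hp,
    Finset.Nat.sum_antidiagonal_eq_sum_range_succ (fun a b => f (p ^ a) * g (p ^ b))]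
  refine sum_congr rfl fun i hi => ?_
  rw [Nat.pow_div (by simpa [Nat.lt_succ_iff] using hi) hp.pos]

/-- The restriction of an arithmetic function to squarefree integers. -/
noncomputable def squarefreePart (g : ArithmeticFunction ℝ) : ArithmeticFunction ℝ :=
  ⟨fun n => if Squarefree n then g n else 0, by simp⟩

theorem squarefreePart_apply (g : ArithmeticFunction ℝ) (n : ℕ) :
    squarefreePart g n = if Squarefree n then g n else 0 := rfl

theorem isMultiplicative_squarefreePart {g : ArithmeticFunction ℝ} (hg : g.IsMultiplicative) :
    (squarefreePart g).IsMultiplicative := by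
  refine ⟨by simp [squarefreePart_apply, hg.1], fun {m n} hmn => ?_⟩
  simp only [squarefreePart_apply, Nat.squarefree_mul hmn, hg.2 hmn]
  by_cases hm : Squarefree m <;> by_cases hn : Squarefree n <;> simp [hm, hn]

/-- Completely multiplicative real arithmetic functions bounded by `1`. -/
structure IsBoundedChar (ψ : ArithmeticFunction ℝ) : Prop where
  map_one : ψ 1 = 1
  map_mul : ∀ m n, ψ (m * n) = ψ m * ψ n
  abs_le_one : ∀ n, |ψ n| ≤ 1

namespace IsBoundedChar

variable {ψ : ArithmeticFunction ℝ}

theorem isMultiplicative (h : IsBoundedChar ψ) : ψ.IsMultiplicative :=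
  ⟨h.map_one, fun _ => h.map_mul _ _⟩

theorem map_pow (h : IsBoundedChar ψ) (p k : ℕ) : ψ (p ^ k) = ψ p ^ k := by
  induction k with
  | zero => simp [h.map_one]
  | succ k ih => rw [pow_succ, h.map_mul, ih, pow_succ]

end IsBoundedChar

/-- The Dirichlet inverse `μψ` of a completely multiplicative function `ψ`. -/
noncomputable def moebiusTwist (ψ : ArithmeticFunction ℝ) : ArithmeticFunction ℝ :=
  (moebius : ArithmeticFunction ℝ).pmul ψ

theorem isMultiplicative_moebiusTwist {ψ : ArithmeticFunction ℝ} (h : IsBoundedChar ψ) :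
    (moebiusTwist ψ).IsMultiplicative :=
  isMultiplicative_moebius.intCast.pmul h.isMultiplicative

theorem moebiusTwist_mul_self {ψ : ArithmeticFunction ℝ} (h : IsBoundedChar ψ) :
    moebiusTwist ψ * ψ = 1 := by
  have key : moebiusTwist ψ * ψ = ((moebius : ArithmeticFunction ℝ) *
      (zeta : ArithmeticFunction ℝ)).pmul ψ := by
    ext n
    simp only [mul_apply, pmul_apply, moebiusTwist, sum_mul]
    refine sum_congr rfl fun x hx => ?_
    obtain ⟨rfl, hn⟩ := Nat.mem_divisorsAntidiagonal.1 hx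
    have : x.2 ≠ 0 := by rintro h0; simp [h0] at hn
    rw [h.map_mul]
    simp [this, mul_assoc]
  rw [key, coe_moebius_mul_coe_zeta]
  ext n
  by_cases hn : n = 1 <;> simp [hn, h.map_one, one_apply]

theorem bellSeries_moebiusTwist {ψ : ArithmeticFunction ℝ} (h : IsBoundedChar ψ) {p : ℕ}
    (hp : p.Prime) : bellSeries p (moebiusTwist ψ) = 1 - PowerSeries.C (ψ p) * PowerSeries.X := by
  ext k
  simp only [bellSeries, moebiusTwist, PowerSeries.coeff_mk, pmul_apply, intCoe_apply, map_sub,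
    PowerSeries.coeff_C_mul, PowerSeries.coeff_X, PowerSeries.coeff_one]
  rcases k with _ | _ | k
  · simp [h.map_one]
  · simp [moebius_apply_prime hp]
  · rw [moebius_apply_prime_pow hp (by simp)]
    simp

section Triple

variable {ψ₁ ψ₂ ψ₃ : ArithmeticFunction ℝ}

theorem bellSeries_squarefreePart (h₁ : IsBoundedChar ψ₁) (h₂ : IsBoundedChar ψ₂)
    (h₃ : IsBoundedChar ψ₃) {p : ℕ} (hp : p.Prime) :
    bellSeries p (squarefreePart (ψ₁ * ψ₂ * ψ₃)) =
      1 + PowerSeries.C (ψ₁ p + ψ₂ p + ψ₃ p) * PowerSeries.X := by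
  ext k
  simp only [bellSeries, squarefreePart_apply, PowerSeries.coeff_mk, map_add,
    PowerSeries.coeff_one]
  rcases k with _ | _ | k
  · simp [h₁.map_one, h₂.map_one, h₃.map_one]
  · have : (ψ₁ * ψ₂ * ψ₃) (p ^ 1) = PowerSeries.coeff 1 (bellSeries p (ψ₁ * ψ₂ * ψ₃)) := by
      simp [bellSeries]
    rw [zero_add, this, bellSeries_mul hp, bellSeries_mul hp]
    simp [PowerSeries.coeff_mul, bellSeries, h₁.map_one, h₂.map_one, h₃.map_one, hp.squarefree,
      Finset.Nat.antidiagonal_succ]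
    ring
  · have : ¬ Squarefree (p ^ (k + 1 + 1)) := by
      rw [Nat.squarefree_pow_iff hp.ne_one (by simp)]
      simp
    simp [this]

/-- The arithmetic function `h` for which `h * ψ₁ * ψ₂ * ψ₃` is the restriction of
`ψ₁ * ψ₂ * ψ₃` to squarefree integers. -/
noncomputable def sieveFactor (ψ₁ ψ₂ ψ₃ : ArithmeticFunction ℝ) : ArithmeticFunction ℝ :=
  squarefreePart (ψ₁ * ψ₂ * ψ₃) * (moebiusTwist ψ₁ * moebiusTwist ψ₂ * moebiusTwist ψ₃)

theorem isMultiplicative_sieveFactor (h₁ : IsBoundedChar ψ₁) (h₂ : IsBoundedChar ψ₂)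
    (h₃ : IsBoundedChar ψ₃) : (sieveFactor ψ₁ ψ₂ ψ₃).IsMultiplicative :=
  (isMultiplicative_squarefreePart
    ((h₁.isMultiplicative.mul h₂.isMultiplicative).mul h₃.isMultiplicative)).mul
    (((isMultiplicative_moebiusTwist h₁).mul (isMultiplicative_moebiusTwist h₂)).mul
      (isMultiplicative_moebiusTwist h₃))

theorem sieveFactor_mul (h₁ : IsBoundedChar ψ₁) (h₂ : IsBoundedChar ψ₂)
    (h₃ : IsBoundedChar ψ₃) :
    sieveFactor ψ₁ ψ₂ ψ₃ * (ψ₁ * ψ₂ * ψ₃) = squarefreePart (ψ₁ * ψ₂ * ψ₃) := by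
  calc _ = squarefreePart (ψ₁ * ψ₂ * ψ₃) * ((moebiusTwist ψ₁ * ψ₁) * (moebiusTwist ψ₂ * ψ₂) *
        (moebiusTwist ψ₃ * ψ₃)) := by rw [sieveFactor]; ring
    _ = _ := by
      rw [moebiusTwist_mul_self h₁, moebiusTwist_mul_self h₂, moebiusTwist_mul_self h₃]
      ring

theorem sieveFactor_prime_pow (h₁ : IsBoundedChar ψ₁) (h₂ : IsBoundedChar ψ₂)
    (h₃ : IsBoundedChar ψ₃) {p : ℕ} (hp : p.Prime) (k : ℕ) :
    sieveFactor ψ₁ ψ₂ ψ₃ (p ^ k) =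
      ((1 + Polynomial.C (ψ₁ p + ψ₂ p + ψ₃ p) * Polynomial.X) *
        ((1 - Polynomial.C (ψ₁ p) * Polynomial.X) * (1 - Polynomial.C (ψ₂ p) * Polynomial.X) *
          (1 - Polynomial.C (ψ₃ p) * Polynomial.X))).coeff k := by
  have : sieveFactor ψ₁ ψ₂ ψ₃ (p ^ k) =
      PowerSeries.coeff k (bellSeries p (sieveFactor ψ₁ ψ₂ ψ₃)) := by simp [bellSeries]
  rw [this, sieveFactor, bellSeries_mul hp, bellSeries_mul hp, bellSeries_mul hp,
    bellSeries_moebiusTwist h₁ hp, bellSeries_moebiusTwist h₂ hp, bellSeries_moebiusTwist h₃ hp,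
    bellSeries_squarefreePart h₁ h₂ h₃ hp, ← Polynomial.coeff_coe]
  simp

end Triple

/-- A nonnegative multiplicative function is summable when its local factors at the primes `p`
are at most `1 + b p` for a summable `b`. -/
theorem summable_of_multiplicative {F b : ℕ → ℝ} (hF : ∀ n, 0 ≤ F n) (hF₀ : F 0 = 0)
    (hF₁ : F 1 = 1) (hmul : ∀ {m n}, Nat.Coprime m n → F (m * n) = F m * F n)
    (hb₀ : ∀ n, 0 ≤ b n) (hb : Summable b)
    (hsum : ∀ {p : ℕ}, p.Prime → Summable fun k => F (p ^ k))
    (hle : ∀ {p : ℕ}, p.Prime → ∑' k, F (p ^ k) ≤ 1 + b p) : Summable F := by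
  refine summable_of_sum_range_le (c := Real.exp (∑' n, b n)) hF fun n => ?_
  obtain ⟨h1, h2⟩ := EulerProduct.summable_and_hasSum_smoothNumbers_prod_primesBelow_tsum
    (f := F) hF₁ hmul (fun hp => (hsum hp).norm) n
  have hprod : ∏ p ∈ n.primesBelow, ∑' k, F (p ^ k) ≤ Real.exp (∑' n, b n) := by
    calc _ ≤ ∏ p ∈ n.primesBelow, Real.exp (b p) := by
          refine prod_le_prod (fun p _ => tsum_nonneg fun k => hF _) fun p hp => ?_
          refine (hle (Nat.prime_of_mem_primesBelow hp)).trans ?_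
          rw [add_comm]
          exact Real.add_one_le_exp _
      _ = Real.exp (∑ p ∈ n.primesBelow, b p) := (Real.exp_sum _ _).symm
      _ ≤ _ := Real.exp_le_exp.2 (hb.sum_le_tsum _ fun i _ => hb₀ i)
  refine le_trans ?_ hprod
  have hind : HasSum ((n.smoothNumbers : Set ℕ).indicator F)
      (∏ p ∈ n.primesBelow, ∑' k, F (p ^ k)) := hasSum_subtype_iff_indicator.1 h2
  refine le_trans (sum_le_sum fun i hi => ?_)
    (sum_le_hasSum (range n) (fun i _ => Set.indicator_nonneg (fun _ _ => hF _) i) hind)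
  rcases eq_or_ne i 0 with rfl | hi0
  · rw [hF₀]
    exact Set.indicator_nonneg (fun _ _ => hF _) _
  · rw [Set.indicator_of_mem]
    exact Nat.mem_smoothNumbers_of_lt (Nat.pos_of_ne_zero hi0) (mem_range.1 hi)

section Triple

variable {ψ₁ ψ₂ ψ₃ : ArithmeticFunction ℝ}

theorem sieveFactor_prime_pow_eq (h₁ : IsBoundedChar ψ₁) (h₂ : IsBoundedChar ψ₂)
    (h₃ : IsBoundedChar ψ₃) {p : ℕ} (hp : p.Prime) {e₁ e₂ e₃ : ℝ}
    (he₁ : e₁ = ψ₁ p + ψ₂ p + ψ₃ p) (he₂ : e₂ = ψ₁ p * ψ₂ p + ψ₁ p * ψ₃ p + ψ₂ p * ψ₃ p)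
    (he₃ : e₃ = ψ₁ p * ψ₂ p * ψ₃ p) (k : ℕ) :
    sieveFactor ψ₁ ψ₂ ψ₃ (p ^ k) = if k = 0 then 1 else if k = 2 then e₂ - e₁ ^ 2
      else if k = 3 then e₁ * e₂ - e₃ else if k = 4 then -(e₁ * e₃) else 0 := by
  have : (1 + Polynomial.C (ψ₁ p + ψ₂ p + ψ₃ p) * Polynomial.X) *
      ((1 - Polynomial.C (ψ₁ p) * Polynomial.X) * (1 - Polynomial.C (ψ₂ p) * Polynomial.X) *
          (1 - Polynomial.C (ψ₃ p) * Polynomial.X)) =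
      Polynomial.C 1 + Polynomial.C (e₂ - e₁ ^ 2) * Polynomial.X ^ 2 +
        Polynomial.C (e₁ * e₂ - e₃) * Polynomial.X ^ 3 +
        Polynomial.C (-(e₁ * e₃)) * Polynomial.X ^ 4 := by
    subst he₁ he₂ he₃
    simp only [map_add, map_mul, map_sub, map_neg, map_pow, map_one]
    ring
  rw [sieveFactor_prime_pow h₁ h₂ h₃ hp, this]
  simp only [Polynomial.coeff_add, Polynomial.coeff_C_mul, Polynomial.coeff_X_pow,
    Polynomial.coeff_C]
  split_ifs <;> first | omega | simp

theorem hasSum_sieveFactor_prime_pow (h₁ : IsBoundedChar ψ₁) (h₂ : IsBoundedChar ψ₂)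
    (h₃ : IsBoundedChar ψ₃) {p : ℕ} (hp : p.Prime) {G : ℕ → ℝ → ℝ} (hG : ∀ k, G k 0 = 0) :
    HasSum (fun k => G k (sieveFactor ψ₁ ψ₂ ψ₃ (p ^ k)))
      (∑ k ∈ range 5, G k (sieveFactor ψ₁ ψ₂ ψ₃ (p ^ k))) := by
  refine hasSum_sum_of_ne_finset_zero fun k hk => ?_
  have : 5 ≤ k := by simpa using hk
  rw [sieveFactor_prime_pow_eq h₁ h₂ h₃ hp rfl rfl rfl]
  rw [if_neg (by omega), if_neg (by omega), if_neg (by omega), if_neg (by omega), hG]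

theorem abs_sieveFactor_prime_pow_le (h₁ : IsBoundedChar ψ₁) (h₂ : IsBoundedChar ψ₂)
    (h₃ : IsBoundedChar ψ₃) {p : ℕ} (hp : p.Prime) (k : ℕ) :
    |sieveFactor ψ₁ ψ₂ ψ₃ (p ^ k)| ≤ 12 := by
  have a₁ := h₁.abs_le_one p
  have a₂ := h₂.abs_le_one p
  have a₃ := h₃.abs_le_one p
  set x := ψ₁ p
  set y := ψ₂ p
  set z := ψ₃ p
  have hmul : ∀ {u v A B : ℝ}, |u| ≤ A → |v| ≤ B → |u * v| ≤ A * B := fun hu hv => by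
    rw [abs_mul]
    exact mul_le_mul hu hv (abs_nonneg _) ((abs_nonneg _).trans hu)
  have e1 : |x + y + z| ≤ 3 := (abs_add_three _ _ _).trans (by linarith)
  have e2 : |x * y + x * z + y * z| ≤ 3 := (abs_add_three _ _ _).trans (by
    linarith [hmul a₁ a₂, hmul a₁ a₃, hmul a₂ a₃])
  have e3 : |x * y * z| ≤ 1 := by linarith [hmul (hmul a₁ a₂) a₃]
  rw [sieveFactor_prime_pow_eq h₁ h₂ h₃ hp rfl rfl rfl]
  split_ifs
  · norm_num
  · rw [sq]
    linarith [abs_sub (x * y + x * z + y * z) ((x + y + z) * (x + y + z)), hmul e1 e1]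
  · linarith [abs_sub ((x + y + z) * (x * y + x * z + y * z)) (x * y * z), hmul e1 e2]
  · rw [abs_neg]
    linarith [hmul e1 e3]
  · norm_num

theorem summable_abs_sieveFactor_mul_rpow (h₁ : IsBoundedChar ψ₁) (h₂ : IsBoundedChar ψ₂)
    (h₃ : IsBoundedChar ψ₃) :
    Summable fun n : ℕ => |sieveFactor ψ₁ ψ₂ ψ₃ n| * (n : ℝ) ^ (-(3 / 4) : ℝ) := by
  have hm := isMultiplicative_sieveFactor h₁ h₂ h₃
  have hloc : ∀ {p : ℕ}, p.Prime → HasSum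
      (fun k : ℕ => |sieveFactor ψ₁ ψ₂ ψ₃ (p ^ k)| * ((p ^ k : ℕ) : ℝ) ^ (-(3 / 4) : ℝ))
      (∑ k ∈ range 5, |sieveFactor ψ₁ ψ₂ ψ₃ (p ^ k)| * ((p ^ k : ℕ) : ℝ) ^ (-(3 / 4) : ℝ)) :=
    fun {p} hp => hasSum_sieveFactor_prime_pow h₁ h₂ h₃ hp
      (G := fun k x => |x| * ((p ^ k : ℕ) : ℝ) ^ (-(3 / 4) : ℝ)) (by simp)
  refine summable_of_multiplicative (b := fun n => 36 * (n : ℝ) ^ (-(3 / 2) : ℝ))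
    (fun n => by positivity) (by simp) (by simp [hm.1]) (fun {m n} hmn => ?_)
    (fun n => by positivity) ((Real.summable_nat_rpow.2 (by norm_num)).mul_left _)
    (fun hp => (hloc hp).summable) (fun {p} hp => ?_)
  · rw [hm.2 hmn, abs_mul, Nat.cast_mul, Real.mul_rpow (by positivity) (by positivity)]
    ring
  · rw [(hloc hp).tsum_eq]
    have hterm : ∀ k, 2 ≤ k →
        |sieveFactor ψ₁ ψ₂ ψ₃ (p ^ k)| * ((p ^ k : ℕ) : ℝ) ^ (-(3 / 4) : ℝ) ≤
          12 * (p : ℝ) ^ (-(3 / 2) : ℝ) := by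
      intro k hk
      have hp1 : (1 : ℝ) ≤ p := by exact_mod_cast hp.one_le
      refine mul_le_mul (abs_sieveFactor_prime_pow_le h₁ h₂ h₃ hp k) ?_ (by positivity)
        (by norm_num)
      rw [Nat.cast_pow, ← Real.rpow_natCast, ← Real.rpow_mul (by positivity)]
      refine Real.rpow_le_rpow_of_exponent_le hp1 ?_
      have : (2 : ℝ) ≤ k := by exact_mod_cast hk
      linarith
    have h0 : sieveFactor ψ₁ ψ₂ ψ₃ (p ^ 0) = 1 := by
      rw [sieveFactor_prime_pow_eq h₁ h₂ h₃ hp rfl rfl rfl, if_pos rfl]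
    have h1 : sieveFactor ψ₁ ψ₂ ψ₃ (p ^ 1) = 0 := by
      rw [sieveFactor_prime_pow_eq h₁ h₂ h₃ hp rfl rfl rfl]
      norm_num
    rw [sum_range_succ, sum_range_succ, sum_range_succ, sum_range_succ, sum_range_succ, h0, h1]
    have := hterm 2 le_rfl
    have := hterm 3 (by norm_num)
    have := hterm 4 (by norm_num)
    simp only [range_zero, sum_empty, abs_one, pow_zero, Nat.cast_one, Real.one_rpow, abs_zero,
      zero_mul]
    linarith

theorem summable_abs_sieveFactor_div_mul_log (h₁ : IsBoundedChar ψ₁) (h₂ : IsBoundedChar ψ₂)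
    (h₃ : IsBoundedChar ψ₃) :
    Summable fun n : ℕ => |sieveFactor ψ₁ ψ₂ ψ₃ n| / n * (1 + Real.log n) := by
  refine Summable.of_nonneg_of_le (fun n => mul_nonneg (by positivity)
    (by linarith [Real.log_natCast_nonneg n])) (fun n => ?_)
    ((summable_abs_sieveFactor_mul_rpow h₁ h₂ h₃).mul_left 5)
  rcases Nat.eq_zero_or_pos n with rfl | hn
  · simp
  have hn' : (1 : ℝ) ≤ n := by exact_mod_cast hn
  have hlog : Real.log n ≤ (n : ℝ) ^ (1 / 4 : ℝ) / (1 / 4) :=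
    Real.log_le_rpow_div (by positivity) (by norm_num)
  have hone : 1 ≤ (n : ℝ) ^ (1 / 4 : ℝ) := Real.one_le_rpow hn' (by norm_num)
  have hexp : (n : ℝ) ^ (-(3 / 4) : ℝ) = (n : ℝ) ^ (1 / 4 : ℝ) / n := by
    rw [← Real.rpow_sub_one (by positivity)]
    norm_num
  rw [hexp]
  calc _ ≤ |sieveFactor ψ₁ ψ₂ ψ₃ n| / n * (5 * (n : ℝ) ^ (1 / 4 : ℝ)) := by
        gcongr
        linarith
    _ = _ := by ring

theorem summable_abs_sieveFactor_div (h₁ : IsBoundedChar ψ₁) (h₂ : IsBoundedChar ψ₂)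
    (h₃ : IsBoundedChar ψ₃) : Summable fun n : ℕ => |sieveFactor ψ₁ ψ₂ ψ₃ n| / n :=
  Summable.of_nonneg_of_le (fun n => by positivity)
    (fun n => le_mul_of_one_le_right (by positivity) (by linarith [Real.log_natCast_nonneg n]))
    (summable_abs_sieveFactor_div_mul_log h₁ h₂ h₃)

end Triple

/-- The principal character modulo `2`. -/
noncomputable def oddChar : ArithmeticFunction ℝ := ⟨fun n => if n % 2 = 1 then 1 else 0, by simp⟩

theorem oddChar_apply (n : ℕ) : oddChar n = if n % 2 = 1 then 1 else 0 := rfl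

theorem isBoundedChar_oddChar : IsBoundedChar oddChar where
  map_one := by simp [oddChar_apply]
  map_mul m n := by
    simp only [oddChar_apply, Nat.mul_mod m n]
    rcases Nat.mod_two_eq_zero_or_one m with h | h <;>
    rcases Nat.mod_two_eq_zero_or_one n with h' | h' <;> simp [h, h']
  abs_le_one n := by rw [oddChar_apply]; split_ifs <;> simp

/-- The nonprincipal character modulo `4`. -/
noncomputable def chiFour : ArithmeticFunction ℝ := ⟨fun n => (ZMod.χ₄ n : ℝ), by simp⟩

theorem chiFour_apply (n : ℕ) :
    chiFour n = if n % 2 = 0 then 0 else if n % 4 = 1 then 1 else -1 := by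
  change ((ZMod.χ₄ n : ℤ) : ℝ) = _
  rw [ZMod.χ₄_nat_eq_if_mod_four]
  split_ifs <;> simp

theorem isBoundedChar_chiFour : IsBoundedChar chiFour where
  map_one := by simp [chiFour_apply]
  map_mul m n := by
    change ((ZMod.χ₄ (m * n : ℕ) : ℤ) : ℝ) = (ZMod.χ₄ m : ℤ) * (ZMod.χ₄ n : ℤ)
    rw [Nat.cast_mul, map_mul, Int.cast_mul]
  abs_le_one n := by rw [chiFour_apply]; split_ifs <;> simp

/-- The summatory function of an arithmetic function. -/
noncomputable def summatory (f : ArithmeticFunction ℝ) (Y : ℝ) : ℝ := ∑ n ∈ Ioc 0 ⌊Y⌋₊, f n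

theorem summatory_mul (f g : ArithmeticFunction ℝ) (Y : ℝ) :
    summatory (f * g) Y = ∑ n ∈ Ioc 0 ⌊Y⌋₊, f n * summatory g (Y / n) := by
  simp only [summatory, sum_Ioc_mul_eq_sum_sum, Nat.floor_div_natCast]

theorem one_le_div_of_mem_Ioc_floor {Y : ℝ} {n : ℕ} (hn : n ∈ Ioc 0 ⌊Y⌋₊) :
    (1 : ℝ) ≤ n ∧ 1 ≤ Y / n := by
  obtain ⟨h0, h1⟩ := mem_Ioc.1 hn
  have h0' : (1 : ℝ) ≤ n := by exact_mod_cast h0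
  exact ⟨h0', (one_le_div (by positivity)).2 ((Nat.le_floor_iff' h0.ne').1 h1)⟩

theorem abs_summatory_chiFour_le (Y : ℝ) : |summatory chiFour Y| ≤ 1 := by
  have key : ∀ N : ℕ, ∑ n ∈ Ioc 0 N, chiFour n = if N % 4 = 1 ∨ N % 4 = 2 then 1 else 0 := by
    intro N
    induction N with
    | zero => simp
    | succ N ih =>
      rw [sum_Ioc_succ_top (by simp), ih, chiFour_apply]
      split_ifs <;> first | omega | norm_num
  rw [summatory, key]
  split_ifs <;> simp

theorem abs_summatory_mul_chiFour_le {ψ₁ ψ₂ : ArithmeticFunction ℝ} (h₁ : IsBoundedChar ψ₁)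
    (h₂ : IsBoundedChar ψ₂) {Y : ℝ} (hY : 1 ≤ Y) :
    |summatory (ψ₁ * ψ₂ * chiFour) Y| ≤ Y * (1 + Real.log Y) := by
  have step : ∀ {Z : ℝ}, 0 ≤ Z → |summatory (ψ₂ * chiFour) Z| ≤ Z := by
    intro Z hZ
    rw [summatory_mul]
    calc _ ≤ ∑ n ∈ Ioc 0 ⌊Z⌋₊, (1 : ℝ) := by
          refine (abs_sum_le_sum_abs _ _).trans (sum_le_sum fun n _ => ?_)
          rw [abs_mul]
          exact mul_le_one₀ (h₂.abs_le_one n) (abs_nonneg _) (abs_summatory_chiFour_le _)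
      _ ≤ Z := by simpa using Nat.floor_le hZ
  rw [mul_assoc, summatory_mul]
  calc _ ≤ ∑ n ∈ Ioc 0 ⌊Y⌋₊, Y * ((n : ℝ)⁻¹) := by
        refine (abs_sum_le_sum_abs _ _).trans (sum_le_sum fun n _ => ?_)
        rw [abs_mul, ← div_eq_mul_inv]
        have := step (Z := Y / n) (by positivity)
        exact (mul_le_of_le_one_left (abs_nonneg _) (h₁.abs_le_one n)).trans this
    _ = Y * (harmonic ⌊Y⌋₊ : ℚ) := by
        rw [← mul_sum, harmonic_eq_sum_Icc]
        push_cast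
        rfl
    _ ≤ _ := by
        gcongr
        exact harmonic_floor_le_one_add_log Y hY

theorem sum_oddChar_mul (g : ℕ → ℝ) (N : ℕ) :
    ∑ n ∈ Ioc 0 N, oddChar n * g n = ∑ k ∈ range ((N + 1) / 2), g (2 * k + 1) := by
  induction N with
  | zero => simp
  | succ N ih =>
    rw [sum_Ioc_succ_top (by simp), ih, oddChar_apply]
    rcases Nat.even_or_odd' N with ⟨m, rfl | rfl⟩
    · rw [show (2 * m + 1) / 2 = m by omega, show (2 * m + 1 + 1) / 2 = m + 1 by omega,
        if_pos (by omega), sum_range_succ, one_mul]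
    · rw [show (2 * m + 1 + 1) / 2 = m + 1 by omega,
        show (2 * m + 1 + 1 + 1) / 2 = m + 1 by omega, if_neg (by omega), zero_mul, add_zero]

theorem le_two_mul_half_floor_add_one {Y : ℝ} (hY : 1 ≤ Y) :
    Y ≤ 2 * ((⌊Y⌋₊ + 1) / 2 : ℕ) + 1 ∧ 2 * (((⌊Y⌋₊ + 1) / 2 : ℕ) : ℝ) + 1 ≤ Y + 2 := by
  have h1 : ⌊Y⌋₊ + 1 ≤ 2 * ((⌊Y⌋₊ + 1) / 2) + 1 := by omega
  have h2 : 2 * ((⌊Y⌋₊ + 1) / 2) + 1 ≤ ⌊Y⌋₊ + 2 := by omega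
  have h1' : ((⌊Y⌋₊ : ℝ) + 1) ≤ 2 * ((⌊Y⌋₊ + 1) / 2 : ℕ) + 1 := by exact_mod_cast h1
  have h2' : 2 * (((⌊Y⌋₊ + 1) / 2 : ℕ) : ℝ) + 1 ≤ (⌊Y⌋₊ : ℝ) + 2 := by exact_mod_cast h2
  exact ⟨(Nat.lt_floor_add_one Y).le.trans h1', h2'.trans
    (by linarith [Nat.floor_le (zero_le_one.trans hY)])⟩

theorem abs_log_sub_log_le {Y : ℝ} (hY : 1 ≤ Y) :
    0 ≤ Real.log (2 * ((⌊Y⌋₊ + 1) / 2 : ℕ) + 1) - Real.log Y ∧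
      Real.log (2 * ((⌊Y⌋₊ + 1) / 2 : ℕ) + 1) - Real.log Y ≤ 2 := by
  obtain ⟨h1, h2⟩ := le_two_mul_half_floor_add_one hY
  refine ⟨sub_nonneg.2 (Real.log_le_log (by linarith) h1), ?_⟩
  rw [← Real.log_div (by positivity) (by positivity)]
  refine (Real.log_le_sub_one_of_pos (by positivity)).trans ?_
  have : (2 * (((⌊Y⌋₊ + 1) / 2 : ℕ) : ℝ) + 1) / Y ≤ 3 := by
    rw [div_le_iff₀ (by linarith)]
    linarith
  linarith

theorem log_add_two_sub_log {m : ℝ} (hm : 1 ≤ m) :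
    2 / (m + 2) ≤ Real.log (m + 2) - Real.log m ∧ Real.log (m + 2) - Real.log m ≤ 2 / m := by
  rw [← Real.log_div (by positivity) (by positivity)]
  constructor
  · refine le_trans (le_of_eq ?_) (Real.one_sub_inv_le_log_of_pos (by positivity))
    field_simp
    ring
  · refine (Real.log_le_sub_one_of_pos (by positivity)).trans (le_of_eq ?_)
    field_simp
    ring

theorem abs_sum_range_odd_sub_le {g G e : ℝ → ℝ}
    (h : ∀ m, 1 ≤ m → |g m - (G (m + 2) - G m)| ≤ e m) (K : ℕ) :
    |∑ k ∈ range K, g (2 * k + 1) - (G (2 * K + 1) - G 1)| ≤ ∑ k ∈ range K, e (2 * k + 1) := by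
  have htel : G (2 * K + 1) - G 1 = ∑ k ∈ range K, (G (2 * k + 1 + 2) - G (2 * k + 1)) := by
    have := sum_range_sub (fun k : ℕ => G (2 * k + 1)) K
    simp only [Nat.cast_zero, mul_zero, zero_add] at this
    rw [← this]
    refine sum_congr rfl fun k _ => ?_
    push_cast
    ring_nf
  rw [htel, ← sum_sub_distrib]
  exact (abs_sum_le_sum_abs _ _).trans
    (sum_le_sum fun k _ => h _ (by linarith [k.cast_nonneg (α := ℝ)]))

theorem abs_sum_range_odd_inv_sub_le (K : ℕ) :
    |∑ k ∈ range K, (1 : ℝ) / (2 * k + 1) - Real.log (2 * K + 1) / 2| ≤ 1 := by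
  have h := abs_sum_range_odd_sub_le (g := fun m => 1 / m) (G := fun m => Real.log m / 2)
    (e := fun m => 1 / m - 1 / (m + 2)) (fun m hm => by
      obtain ⟨h1, h2⟩ := log_add_two_sub_log hm
      have e1 : 2 / (m + 2) = 2 * (1 / (m + 2)) := by ring
      have e2 : 2 / m = 2 * (1 / m) := by ring
      rw [abs_le]
      constructor <;> linarith) K
  have htel := sum_range_sub (fun k : ℕ => -(1 / (2 * (k : ℝ) + 1))) K
  have hsum : ∑ k ∈ range K, (1 / (2 * (k : ℝ) + 1) - 1 / (2 * (k : ℝ) + 1 + 2)) ≤ 1 := by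
    have hpos : 0 ≤ 1 / (2 * (K : ℝ) + 1) := by positivity
    calc _ = _ := (sum_congr rfl fun k _ => by push_cast; ring).trans htel
      _ ≤ 1 := by norm_num; simpa using hpos
  simp only [Real.log_one] at h
  refine le_trans (le_of_eq ?_) (h.trans hsum)
  congr 1
  ring

theorem abs_sum_range_odd_log_div_sub_le (K : ℕ) :
    |∑ k ∈ range K, Real.log (2 * k + 1) / (2 * k + 1) - Real.log (2 * K + 1) ^ 2 / 4| ≤
      Real.log (2 * K + 1) + 2 := by
  have h := abs_sum_range_odd_sub_le (g := fun m => Real.log m / m)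
    (G := fun m => Real.log m ^ 2 / 4) (e := fun m => 2 * (1 / m)) (fun m hm => by
      obtain ⟨h1, h2⟩ := log_add_two_sub_log hm
      have hm0 : 0 < m := by linarith
      have hl : 0 ≤ Real.log m := Real.log_nonneg hm
      have hlm : Real.log m ≤ m := (Real.log_le_sub_one_of_pos hm0).trans (by linarith)
      set a := Real.log m
      set b := Real.log (m + 2)
      have hinv : 1 / m ≤ 1 := by rw [div_le_one hm0]; exact hm
      have hmm : m * (1 / m) = 1 := by field_simp
      have e2 : 2 / m = 2 * (1 / m) := by ring
      have e3 : a / m = a * (1 / m) := by ring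
      have e1 : 2 / (m + 2) = 2 * (1 / (m + 2)) := by ring
      have e4 : 1 / m - 1 / (m + 2) = 2 * (1 / m) * (1 / (m + 2)) := by field_simp; ring
      have hq : 0 ≤ 1 / (m + 2) := by positivity
      have hr : 0 ≤ 1 / m := by positivity
      have ha2 : a * (1 / (m + 2)) ≤ 1 := by
        rw [mul_one_div, div_le_one (by positivity)]; linarith
      rw [e1] at h1
      rw [e2] at h2
      rw [e3]
      have hba : 0 ≤ b - a := by linarith
      have hfac : b ^ 2 / 4 - a ^ 2 / 4 = a * (b - a) / 2 + (b - a) ^ 2 / 4 := by ring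
      rw [hfac, abs_le]
      have u1 := mul_le_mul_of_nonneg_left h1 hl
      have u2 := mul_le_mul_of_nonneg_left h2 hl
      have u3 : (b - a) ^ 2 ≤ 4 * (1 / m) := by nlinarith
      have u4 : a * (1 / m) - a * (1 / (m + 2)) ≤ 2 * (1 / m) := by
        rw [← mul_sub, e4]
        nlinarith
      constructor <;> nlinarith [sq_nonneg (b - a)]) K
  have hL := abs_le.1 (abs_sum_range_odd_inv_sub_le K)
  simp only [Real.log_one, ← mul_sum] at h
  refine le_trans (le_of_eq ?_) (h.trans (by linarith [hL.2]))
  congr 1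
  ring

theorem abs_sum_oddChar_div_sub_le {Y : ℝ} (hY : 1 ≤ Y) :
    |∑ n ∈ Ioc 0 ⌊Y⌋₊, oddChar n * (1 / n) - Real.log Y / 2| ≤ 2 := by
  have h := abs_le.1 (abs_sum_range_odd_inv_sub_le ((⌊Y⌋₊ + 1) / 2))
  obtain ⟨h1, h2⟩ := abs_log_sub_log_le hY
  rw [sum_oddChar_mul (fun n => 1 / (n : ℝ)), abs_le]
  push_cast
  constructor <;> linarith [h.1, h.2]

theorem abs_sum_oddChar_log_div_sub_le {Y : ℝ} (hY : 1 ≤ Y) :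
    |∑ n ∈ Ioc 0 ⌊Y⌋₊, oddChar n * (Real.log n / n) - Real.log Y ^ 2 / 4| ≤
      5 * (1 + Real.log Y) := by
  have h := abs_le.1 (abs_sum_range_odd_log_div_sub_le ((⌊Y⌋₊ + 1) / 2))
  obtain ⟨h1, h2⟩ := abs_log_sub_log_le hY
  have hl := Real.log_nonneg hY
  rw [sum_oddChar_mul (fun n => Real.log n / (n : ℝ)), abs_le]
  push_cast
  constructor <;> nlinarith [h.1, h.2]

theorem abs_summatory_oddChar_sub_le {Y : ℝ} (hY : 1 ≤ Y) :
    |summatory oddChar Y - Y / 2| ≤ 1 := by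
  have h := sum_oddChar_mul (fun _ => 1) ⌊Y⌋₊
  simp only [mul_one, sum_const, card_range, nsmul_eq_mul] at h
  obtain ⟨h1, h2⟩ := le_two_mul_half_floor_add_one hY
  rw [summatory, h, abs_le]
  constructor <;> linarith

theorem oddChar_nonneg (n : ℕ) : 0 ≤ oddChar n := by
  rw [oddChar_apply]
  split_ifs <;> simp

theorem abs_summatory_oddChar_mul_sub_le {f : ArithmeticFunction ℝ} {g : ℝ → ℝ} {E : ℝ → ℝ}
    (h : ∀ Z, 1 ≤ Z → |summatory f Z - g Z| ≤ E Z) (Y : ℝ) :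
    |summatory (oddChar * f) Y - ∑ n ∈ Ioc 0 ⌊Y⌋₊, oddChar n * g (Y / n)| ≤
      ∑ n ∈ Ioc 0 ⌊Y⌋₊, oddChar n * E (Y / n) := by
  rw [summatory_mul, ← sum_sub_distrib]
  refine (abs_sum_le_sum_abs _ _).trans (sum_le_sum fun n hn => ?_)
  rw [← mul_sub, abs_mul, abs_of_nonneg (oddChar_nonneg n)]
  exact mul_le_mul_of_nonneg_left (h _ (one_le_div_of_mem_Ioc_floor hn).2) (oddChar_nonneg n)

theorem abs_summatory_oddChar_mul_oddChar_sub_le {Y : ℝ} (hY : 1 ≤ Y) :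
    |summatory (oddChar * oddChar) Y - Y * Real.log Y / 4| ≤ 3 * Y := by
  have h := abs_summatory_oddChar_mul_sub_le (f := oddChar) (g := fun Z => Z / 2)
    (E := fun _ => 1) (fun Z hZ => abs_summatory_oddChar_sub_le hZ) Y
  have e1 : ∑ n ∈ Ioc 0 ⌊Y⌋₊, oddChar n * (Y / n / 2) =
      Y / 2 * ∑ n ∈ Ioc 0 ⌊Y⌋₊, oddChar n * (1 / n) := by
    rw [mul_sum]
    exact sum_congr rfl fun n _ => by ring
  have e2 : ∑ n ∈ Ioc 0 ⌊Y⌋₊, oddChar n * 1 = summatory oddChar Y := by simp [summatory]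
  have hL := abs_le.1 (abs_sum_oddChar_div_sub_le hY)
  have hD := abs_le.1 (abs_summatory_oddChar_sub_le hY)
  rw [e1, e2] at h
  have h := abs_le.1 h
  rw [abs_le]
  constructor <;> nlinarith [h.1, h.2, hL.1, hL.2, hD.1, hD.2]

theorem abs_summatory_oddChar_cube_sub_le {Y : ℝ} (hY : 1 ≤ Y) :
    |summatory (oddChar * oddChar * oddChar) Y - Y * Real.log Y ^ 2 / 16| ≤
      8 * (Y * (1 + Real.log Y)) := by
  have h := abs_summatory_oddChar_mul_sub_le (f := oddChar * oddChar)
    (g := fun Z => Z * Real.log Z / 4) (E := fun Z => 3 * Z)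
    (fun Z hZ => abs_summatory_oddChar_mul_oddChar_sub_le hZ) Y
  have e1 : ∑ n ∈ Ioc 0 ⌊Y⌋₊, oddChar n * (Y / n * Real.log (Y / n) / 4) =
      Y / 4 * (Real.log Y * ∑ n ∈ Ioc 0 ⌊Y⌋₊, oddChar n * (1 / n) -
        ∑ n ∈ Ioc 0 ⌊Y⌋₊, oddChar n * (Real.log n / n)) := by
    rw [mul_sum, ← sum_sub_distrib, mul_sum]
    refine sum_congr rfl fun n hn => ?_
    have := (one_le_div_of_mem_Ioc_floor hn).1
    rw [Real.log_div (by positivity) (by positivity)]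
    ring
  have e2 : ∑ n ∈ Ioc 0 ⌊Y⌋₊, oddChar n * (3 * (Y / n)) =
      3 * Y * ∑ n ∈ Ioc 0 ⌊Y⌋₊, oddChar n * (1 / n) := by
    rw [mul_sum]
    exact sum_congr rfl fun n _ => by ring
  have hL := abs_le.1 (abs_sum_oddChar_div_sub_le hY)
  have hM := abs_le.1 (abs_sum_oddChar_log_div_sub_le hY)
  have hl := Real.log_nonneg hY
  rw [e1, e2, ← mul_assoc] at h
  have h := abs_le.1 h
  set L := ∑ n ∈ Ioc 0 ⌊Y⌋₊, oddChar n * (1 / n)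
  set M := ∑ n ∈ Ioc 0 ⌊Y⌋₊, oddChar n * (Real.log n / n)
  set l := Real.log Y
  have hY0 : 0 ≤ Y := by linarith
  have k1 : |l * L - M - l ^ 2 / 4| ≤ 7 * (1 + l) := by
    rw [abs_le]
    constructor <;> nlinarith [hL.1, hL.2, hM.1, hM.2]
  have k2 := abs_le.1 k1
  have k3 := mul_le_mul_of_nonneg_left k2.1 hY0
  have k4 := mul_le_mul_of_nonneg_left k2.2 hY0
  have k5 := mul_le_mul_of_nonneg_left hL.2 hY0
  have k6 := mul_nonneg hY0 hl
  rw [abs_le]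
  constructor <;> nlinarith [h.1, h.2]

theorem sum_div_Ioc_floor_le_tsum {f : ArithmeticFunction ℝ}
    (hf : Summable fun n : ℕ => |f n| / n) (N : ℕ) :
    ∑ n ∈ Ioc 0 N, |f n| / n ≤ ∑' n : ℕ, |f n| / n :=
  hf.sum_le_tsum _ fun n _ => by positivity

theorem abs_summatory_mul_sub_le {f g : ArithmeticFunction ℝ} {G : ℝ → ℝ} {C : ℝ} (hC : 0 ≤ C)
    (hf : Summable fun n : ℕ => |f n| / n)
    (hg : ∀ Z, 1 ≤ Z → |summatory g Z - G Z| ≤ C * (Z * (1 + Real.log Z))) {Y : ℝ} (hY : 1 ≤ Y) :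
    |summatory (f * g) Y - ∑ n ∈ Ioc 0 ⌊Y⌋₊, f n * G (Y / n)| ≤
      C * (∑' n : ℕ, |f n| / n) * (Y * (1 + Real.log Y)) := by
  have hl := Real.log_nonneg hY
  rw [summatory_mul, ← sum_sub_distrib]
  calc _ ≤ ∑ n ∈ Ioc 0 ⌊Y⌋₊, C * (Y * (1 + Real.log Y)) * (|f n| / n) := by
        refine (abs_sum_le_sum_abs _ _).trans (sum_le_sum fun n hn => ?_)
        obtain ⟨hn1, hYn⟩ := one_le_div_of_mem_Ioc_floor hn
        rw [← mul_sub, abs_mul]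
        calc _ ≤ |f n| * (C * (Y / n * (1 + Real.log (Y / n)))) := by
              gcongr
              exact hg _ hYn
          _ ≤ |f n| * (C * (Y / n * (1 + Real.log Y))) := by
              gcongr
              exact div_le_self (by positivity) hn1
          _ = _ := by ring
    _ = C * (Y * (1 + Real.log Y)) * ∑ n ∈ Ioc 0 ⌊Y⌋₊, |f n| / n := by rw [mul_sum]
    _ ≤ C * (Y * (1 + Real.log Y)) * ∑' n : ℕ, |f n| / n := by
        gcongr
        exact sum_div_Ioc_floor_le_tsum hf _
    _ = _ := by ring

theorem abs_sum_mul_log_sq_sub_le {f : ArithmeticFunction ℝ}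
    (hf : Summable fun n : ℕ => |f n| / n)
    (hf' : Summable fun n : ℕ => |f n| / n * (1 + Real.log n)) {Y : ℝ} (hY : 1 ≤ Y) :
    |∑ n ∈ Ioc 0 ⌊Y⌋₊, f n * (Y / n * Real.log (Y / n) ^ 2) -
        Y * Real.log Y ^ 2 * ∑' n : ℕ, f n / n| ≤
      2 * (∑' n : ℕ, |f n| / n * (1 + Real.log n)) * (Y * (1 + Real.log Y)) := by
  have hl := Real.log_nonneg hY
  have hY0 : 0 < Y := by linarith
  have hfs : Summable fun n : ℕ => f n / n := by
    refine Summable.of_norm (hf.congr fun n => ?_)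
    rw [Real.norm_eq_abs, abs_div, Nat.abs_cast]
  have h1 : HasSum (fun n => if n ∈ Ioc 0 ⌊Y⌋₊ then f n * (Y / n * Real.log (Y / n) ^ 2) else 0)
      (∑ n ∈ Ioc 0 ⌊Y⌋₊, f n * (Y / n * Real.log (Y / n) ^ 2)) := by
    rw [← sum_congr rfl fun n (hn : n ∈ Ioc 0 ⌊Y⌋₊) => if_pos hn]
    exact hasSum_sum_of_ne_finset_zero fun n hn => if_neg hn
  have h2 := h1.sub (hfs.hasSum.mul_left (Y * Real.log Y ^ 2))
  rw [← h2.tsum_eq, ← Real.norm_eq_abs]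
  refine (tsum_of_norm_bounded (hf'.hasSum.mul_left (2 * (Y * (1 + Real.log Y))))
    fun n => ?_).trans (le_of_eq (by ring))
  rw [Real.norm_eq_abs]
  rcases Nat.eq_zero_or_pos n with rfl | hn
  · simp
  have hn1 : (1 : ℝ) ≤ n := by exact_mod_cast hn
  have hln := Real.log_nonneg hn1
  have hfn : 0 ≤ |f n| / n := by positivity
  suffices h : ∃ u : ℝ, |u - Real.log Y ^ 2| ≤ 2 * Real.log Y * Real.log n ∧
      (if n ∈ Ioc 0 ⌊Y⌋₊ then f n * (Y / n * Real.log (Y / n) ^ 2) else 0) = Y * (f n / n) * u by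
    obtain ⟨u, hu, he⟩ := h
    rw [he, show Y * (f n / n) * u - Y * Real.log Y ^ 2 * (f n / n) =
      Y * (f n / n) * (u - Real.log Y ^ 2) by ring, abs_mul, abs_mul, abs_div, Nat.abs_cast,
      abs_of_pos hY0]
    calc _ ≤ Y * (|f n| / n) * (2 * ((1 + Real.log Y) * (1 + Real.log n))) := by
          gcongr
          nlinarith
      _ = _ := by ring
  split_ifs with hmem
  · have hYn := Real.log_nonneg (one_le_div_of_mem_Ioc_floor hmem).2
    rw [Real.log_div (by positivity) (by positivity)] at hYn ⊢
    refine ⟨(Real.log Y - Real.log n) ^ 2, ?_, by ring⟩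
    rw [abs_le]
    constructor <;> nlinarith
  · refine ⟨0, ?_, by simp⟩
    have hlt : Y < n := by
      by_contra! hle
      exact hmem (mem_Ioc.2 ⟨hn, Nat.le_floor hle⟩)
    have := Real.log_le_log hY0 hlt.le
    rw [zero_sub, abs_neg, abs_of_nonneg (by positivity)]
    nlinarith

theorem abs_summatory_squarefreePart_chiFour_le {ψ₁ ψ₂ : ArithmeticFunction ℝ}
    (h₁ : IsBoundedChar ψ₁) (h₂ : IsBoundedChar ψ₂) :
    ∃ C, ∀ Y, 1 ≤ Y →
      |summatory (squarefreePart (ψ₁ * ψ₂ * chiFour)) Y| ≤ C * (Y * (1 + Real.log Y)) := by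
  refine ⟨1 * ∑' n : ℕ, |sieveFactor ψ₁ ψ₂ chiFour n| / n, fun Y hY => ?_⟩
  rw [← sieveFactor_mul h₁ h₂ isBoundedChar_chiFour]
  simpa only [mul_zero, sum_const_zero, sub_zero] using
    abs_summatory_mul_sub_le (G := fun _ => 0) zero_le_one
    (summable_abs_sieveFactor_div h₁ h₂ isBoundedChar_chiFour)
    (fun Z hZ => by simpa using abs_summatory_mul_chiFour_le h₁ h₂ hZ) hY

theorem hasProd_sieveFactor_oddChar :
    HasProd (fun p : Nat.Primes => if (p : ℕ) = 2 then (1 : ℝ) else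
        (1 - 1 / (p : ℝ)) ^ 3 * (1 + 3 / (p : ℝ)))
      (∑' n : ℕ, sieveFactor oddChar oddChar oddChar n / n) := by
  have hψ := isBoundedChar_oddChar
  have hm := isMultiplicative_sieveFactor hψ hψ hψ
  have h := EulerProduct.eulerProduct_hasProd
    (f := fun n : ℕ => sieveFactor oddChar oddChar oddChar n / n) (by simp [hm.1])
    (fun {m n} hmn => by rw [hm.2 hmn, Nat.cast_mul, mul_div_mul_comm])
    ((summable_abs_sieveFactor_div hψ hψ hψ).congr fun n => by
      rw [Real.norm_eq_abs, abs_div, Nat.abs_cast]) (by simp)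
  convert! h using 2 with p
  have hp := p.2
  rw [(hasSum_sieveFactor_prime_pow hψ hψ hψ hp (G := fun k x => x / ((p ^ k : ℕ) : ℝ))
    (by simp)).tsum_eq, sum_congr rfl fun k _ => by
      rw [sieveFactor_prime_pow_eq hψ hψ hψ hp rfl rfl rfl]]
  have hp0 : (p : ℝ) ≠ 0 := by exact_mod_cast hp.ne_zero
  by_cases h2 : (p : ℕ) = 2
  · simp [sum_range_succ, oddChar_apply, h2]
  · have hodd : (p : ℕ) % 2 = 1 := hp.eq_two_or_odd.resolve_left h2
    simp only [sum_range_succ, oddChar_apply, hodd, h2]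
    norm_num
    field_simp
    ring

theorem tsum_sieveFactor_oddChar :
    ∑' n : ℕ, sieveFactor oddChar oddChar oddChar n / n =
      16 / 5 * ∏' p : Nat.Primes, (1 - 1 / (p : ℝ)) ^ 3 * (1 + 3 / (p : ℝ)) := by
  let two : Nat.Primes := ⟨2, Nat.prime_two⟩
  have h := hasProd_sieveFactor_oddChar.mul (hasProd_ite_eq two (5 / 16 : ℝ))
  have h' : HasProd (fun p : Nat.Primes => (1 - 1 / (p : ℝ)) ^ 3 * (1 + 3 / (p : ℝ)))
      ((∑' n : ℕ, sieveFactor oddChar oddChar oddChar n / n) * (5 / 16)) := by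
    have e : (fun p : Nat.Primes => (1 - 1 / (p : ℝ)) ^ 3 * (1 + 3 / (p : ℝ))) =
        fun p : Nat.Primes =>
        (if (p : ℕ) = 2 then (1 : ℝ) else (1 - 1 / (p : ℝ)) ^ 3 * (1 + 3 / (p : ℝ))) *
          if p = two then 5 / 16 else 1 := by
      funext p
      by_cases h2 : p = two
      · subst h2
        rw [if_pos (show (two : ℕ) = 2 from rfl), if_pos rfl]
        norm_num [two]
      · have h2' : (p : ℕ) ≠ 2 := fun hp => h2 (Subtype.ext hp)
        rw [if_neg h2, if_neg h2', mul_one]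
    rw [e]
    exact h
  rw [h'.tprod_eq]
  ring

theorem exists_abs_summatory_squarefreePart_oddChar_sub_le :
    ∃ C, ∀ Y, 1 ≤ Y → |summatory (squarefreePart (oddChar * oddChar * oddChar)) Y -
      Y * Real.log Y ^ 2 / 5 *
        ∏' p : Nat.Primes, (1 - 1 / (p : ℝ)) ^ 3 * (1 + 3 / (p : ℝ))| ≤
      C * (Y * (1 + Real.log Y)) := by
  have hψ := isBoundedChar_oddChar
  have hs := summable_abs_sieveFactor_div hψ hψ hψ
  have hs' := summable_abs_sieveFactor_div_mul_log hψ hψ hψ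
  refine ⟨8 * (∑' n : ℕ, |sieveFactor oddChar oddChar oddChar n| / n) +
    2 * (∑' n : ℕ, |sieveFactor oddChar oddChar oddChar n| / n * (1 + Real.log n)) / 16,
    fun Y hY => ?_⟩
  have h1 := abs_summatory_mul_sub_le (G := fun Z => Z * Real.log Z ^ 2 / 16)
    (by norm_num) hs (fun Z hZ => abs_summatory_oddChar_cube_sub_le hZ) hY
  have h2 := abs_sum_mul_log_sq_sub_le hs hs' hY
  have e : ∑ n ∈ Ioc 0 ⌊Y⌋₊, sieveFactor oddChar oddChar oddChar n *
      (Y / n * Real.log (Y / n) ^ 2 / 16) = (∑ n ∈ Ioc 0 ⌊Y⌋₊,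
        sieveFactor oddChar oddChar oddChar n * (Y / n * Real.log (Y / n) ^ 2)) / 16 := by
    rw [sum_div]
    exact sum_congr rfl fun n _ => by ring
  rw [sieveFactor_mul hψ hψ hψ, e] at h1
  rw [tsum_sieveFactor_oddChar] at h2
  have h1 := abs_le.1 h1
  have h2 := abs_le.1 h2
  rw [abs_le]
  constructor <;> linarith [h1.1, h1.2, h2.1, h2.2]

/-- The indicator of the odd integers congruent to `ε` modulo `4`. -/
noncomputable def residueIndicator (ε : ℕ) : ArithmeticFunction ℝ :=
  ⟨fun n => if n % 2 = 1 ∧ n % 4 = ε then 1 else 0, by simp⟩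

theorem residueIndicator_apply (ε n : ℕ) :
    residueIndicator ε n = if n % 2 = 1 ∧ n % 4 = ε then 1 else 0 := rfl

theorem exists_residueIndicator_add_self {ε : ℕ} (hε : ε ∈ ({1, 3} : Set ℕ)) :
    ∃ k : ℤ, residueIndicator ε + residueIndicator ε = oddChar + k • chiFour := by
  rcases hε with rfl | rfl
  · refine ⟨1, ?_⟩
    ext n
    rw [one_zsmul, ArithmeticFunction.add_apply, ArithmeticFunction.add_apply,
      residueIndicator_apply, oddChar_apply, chiFour_apply]
    split_ifs <;> first | omega | norm_num
  · refine ⟨-1, ?_⟩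
    ext n
    rw [neg_one_zsmul, ArithmeticFunction.add_apply, ArithmeticFunction.add_apply,
      ArithmeticFunction.neg_apply, residueIndicator_apply, oddChar_apply, chiFour_apply]
    split_ifs <;> first | omega | norm_num

/-- The summatory function over squarefree integers, as an additive map. -/
noncomputable def squarefreeSum (Y : ℝ) : ArithmeticFunction ℝ →+ ℝ :=
  AddMonoidHom.mk' (fun f => summatory (squarefreePart f) Y) fun f g => by
    simp only [summatory, squarefreePart_apply, ArithmeticFunction.add_apply, ← sum_add_distrib]
    exact sum_congr rfl fun n _ => by split_ifs <;> simp

theorem squarefreeSum_apply (Y : ℝ) (f : ArithmeticFunction ℝ) :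
    squarefreeSum Y f = summatory (squarefreePart f) Y := rfl

theorem exists_abs_squarefreeSum_residueIndicator_sub_le {ε₁ ε₂ ε₃ : ℕ}
    (hε₁ : ε₁ ∈ ({1, 3} : Set ℕ)) (hε₂ : ε₂ ∈ ({1, 3} : Set ℕ)) (hε₃ : ε₃ ∈ ({1, 3} : Set ℕ)) :
    ∃ C, 0 ≤ C ∧ ∀ Y, 1 ≤ Y → |squarefreeSum Y
        (residueIndicator ε₁ * residueIndicator ε₂ * residueIndicator ε₃) -
      Y * Real.log Y ^ 2 / 40 *
        ∏' p : Nat.Primes, (1 - 1 / (p : ℝ)) ^ 3 * (1 + 3 / (p : ℝ))| ≤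
      C * (Y * (1 + Real.log Y)) := by
  obtain ⟨k₁, h₁⟩ := exists_residueIndicator_add_self hε₁
  obtain ⟨k₂, h₂⟩ := exists_residueIndicator_add_self hε₂
  obtain ⟨k₃, h₃⟩ := exists_residueIndicator_add_self hε₃
  have key : 8 • (residueIndicator ε₁ * residueIndicator ε₂ * residueIndicator ε₃) =
      oddChar * oddChar * oddChar + (k₁ + k₂ + k₃) • (oddChar * oddChar * chiFour) +
        (k₁ * k₂ + k₁ * k₃ + k₂ * k₃) • (oddChar * chiFour * chiFour) +
        (k₁ * k₂ * k₃) • (chiFour * chiFour * chiFour) := by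
    calc _ = (residueIndicator ε₁ + residueIndicator ε₁) *
          (residueIndicator ε₂ + residueIndicator ε₂) *
          (residueIndicator ε₃ + residueIndicator ε₃) := by
          rw [nsmul_eq_mul]
          push_cast
          ring
      _ = _ := by
          rw [h₁, h₂, h₃]
          simp only [zsmul_eq_mul]
          push_cast
          ring
  obtain ⟨C₀, hC₀⟩ := exists_abs_summatory_squarefreePart_oddChar_sub_le
  obtain ⟨C₁, hC₁⟩ := abs_summatory_squarefreePart_chiFour_le isBoundedChar_oddChar
    isBoundedChar_oddChar
  obtain ⟨C₂, hC₂⟩ := abs_summatory_squarefreePart_chiFour_le isBoundedChar_oddChar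
    isBoundedChar_chiFour
  obtain ⟨C₃, hC₃⟩ := abs_summatory_squarefreePart_chiFour_le isBoundedChar_chiFour
    isBoundedChar_chiFour
  set P := ∏' p : Nat.Primes, (1 - 1 / (p : ℝ)) ^ 3 * (1 + 3 / (p : ℝ))
  set a : ℤ := k₁ + k₂ + k₃
  set b : ℤ := k₁ * k₂ + k₁ * k₃ + k₂ * k₃
  set d : ℤ := k₁ * k₂ * k₃
  set C := C₀ + |(a : ℝ)| * C₁ + |(b : ℝ)| * C₂ + |(d : ℝ)| * C₃
  have main : ∀ Y, 1 ≤ Y → |squarefreeSum Y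
      (residueIndicator ε₁ * residueIndicator ε₂ * residueIndicator ε₃) -
        Y * Real.log Y ^ 2 / 40 * P| ≤ C / 8 * (Y * (1 + Real.log Y)) := by
    intro Y hY
    have hmap := congrArg (squarefreeSum Y) key
    simp only [map_add, map_nsmul, map_zsmul] at hmap
    simp only [zsmul_eq_mul, nsmul_eq_mul, Nat.cast_ofNat] at hmap
    have g₀ := abs_le.1 (hC₀ Y hY)
    have hz : ∀ (z : ℤ) {x B : ℝ}, |x| ≤ B → |z * x| ≤ |(z : ℝ)| * B := fun z x B h => by
      rw [abs_mul]
      exact mul_le_mul_of_nonneg_left h (abs_nonneg _)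
    have g₁ := abs_le.1 (hz a (hC₁ Y hY))
    have g₂ := abs_le.1 (hz b (hC₂ Y hY))
    have g₃ := abs_le.1 (hz d (hC₃ Y hY))
    simp only [← squarefreeSum_apply] at g₀ g₁ g₂ g₃
    rw [abs_le]
    simp only [C]
    constructor <;> linarith [g₀.1, g₀.2, g₁.1, g₁.2, g₂.1, g₂.2, g₃.1, g₃.2]
  refine ⟨C / 8, ?_, main⟩
  have := (abs_nonneg _).trans (main 1 le_rfl)
  simpa using this

theorem mul_mul_apply_eq_sum_box (f g h : ArithmeticFunction ℝ) {n N : ℕ} (hn : n ∈ Ioc 0 N) :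
    (f * g * h) n = ∑ t ∈ Ioc 0 N ×ˢ Ioc 0 N ×ˢ Ioc 0 N,
      if t.1 * t.2.1 * t.2.2 = n then f t.1 * g t.2.1 * h t.2.2 else 0 := by
  have two : ∀ (u v : ArithmeticFunction ℝ) {m : ℕ}, m ∈ Ioc 0 N → (u * v) m =
      ∑ a ∈ Ioc 0 N, ∑ b ∈ Ioc 0 N, if a * b = m then u a * v b else 0 := by
    intro u v m hm
    rw [mem_Ioc] at hm
    rw [mul_apply, Nat.divisorsAntidiagonal_eq_prod_filter_of_le hm.1.ne' hm.2, sum_filter,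
      sum_product]
  rw [mul_assoc, two f (g * h) hn, sum_product]
  refine sum_congr rfl fun a ha => ?_
  rw [sum_product]
  have ha0 := (mem_Ioc.1 ha).1
  calc ∑ u ∈ Ioc 0 N, (if a * u = n then f a * (g * h) u else 0)
      = ∑ u ∈ Ioc 0 N, ∑ b ∈ Ioc 0 N, ∑ c ∈ Ioc 0 N,
          if b * c = u then if a * b * c = n then f a * g b * h c else 0 else 0 := by
        refine sum_congr rfl fun u hu => ?_
        rw [two g h hu]
        by_cases hau : a * u = n
        · rw [if_pos hau, mul_sum]
          refine sum_congr rfl fun b _ => ?_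
          rw [mul_sum]
          refine sum_congr rfl fun c _ => ?_
          by_cases hbc : b * c = u
          · rw [if_pos hbc, if_pos hbc, if_pos (by rw [mul_assoc, hbc, hau]), mul_assoc]
          · rw [if_neg hbc, if_neg hbc, mul_zero]
        · rw [if_neg hau]
          symm
          refine sum_eq_zero fun b _ => sum_eq_zero fun c _ => ?_
          by_cases hbc : b * c = u
          · rw [if_pos hbc, if_neg (by rwa [mul_assoc, hbc])]
          · rw [if_neg hbc]
    _ = ∑ b ∈ Ioc 0 N, ∑ c ∈ Ioc 0 N, ∑ u ∈ Ioc 0 N,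
          if b * c = u then if a * b * c = n then f a * g b * h c else 0 else 0 := by
        rw [sum_comm]
        exact sum_congr rfl fun b _ => sum_comm
    _ = _ := by
        refine sum_congr rfl fun b hb => sum_congr rfl fun c hc => ?_
        rw [sum_ite_eq]
        simp only [mem_Ioc] at hn hb hc ⊢
        by_cases habc : a * b * c = n
        · have : b * c ≤ n := by
            rw [← habc, mul_assoc]
            exact Nat.le_mul_of_pos_left _ ha0
          rw [if_pos ⟨Nat.mul_pos hb.1 hc.1, this.trans hn.2⟩]
        · simp [habc]

theorem ncard_triples_eq_squarefreeSum (ε₁ ε₂ ε₃ : ℕ) {K : ℕ} (hK : 0 < K) {Z : ℝ} (hZ : 0 ≤ Z) :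
    (Set.ncard {t : ℕ × ℕ × ℕ |
      0 < t.1 ∧ 0 < t.2.1 ∧ 0 < t.2.2 ∧ Odd t.1 ∧ Odd t.2.1 ∧ Odd t.2.2 ∧
      Squarefree (t.1 * t.2.1 * t.2.2) ∧
      t.1 % 4 = ε₁ ∧ t.2.1 % 4 = ε₂ ∧ t.2.2 % 4 = ε₃ ∧
      ((K * (t.1 * t.2.1 * t.2.2) : ℕ) : ℝ) ≤ Z} : ℝ) =
    squarefreeSum (Z / K) (residueIndicator ε₁ * residueIndicator ε₂ * residueIndicator ε₃) := by
  classical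
  set N := ⌊Z / K⌋₊ with hN
  have hbound : ∀ m : ℕ, ((K * m : ℕ) : ℝ) ≤ Z ↔ m ≤ N := by
    intro m
    rw [hN, Nat.le_floor_iff (by positivity), le_div_iff₀ (by exact_mod_cast hK)]
    push_cast
    rw [mul_comm]
  have hset : {t : ℕ × ℕ × ℕ |
      0 < t.1 ∧ 0 < t.2.1 ∧ 0 < t.2.2 ∧ Odd t.1 ∧ Odd t.2.1 ∧ Odd t.2.2 ∧
      Squarefree (t.1 * t.2.1 * t.2.2) ∧
      t.1 % 4 = ε₁ ∧ t.2.1 % 4 = ε₂ ∧ t.2.2 % 4 = ε₃ ∧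
      ((K * (t.1 * t.2.1 * t.2.2) : ℕ) : ℝ) ≤ Z} =
      ((Ioc 0 N ×ˢ Ioc 0 N ×ˢ Ioc 0 N).filter fun t : ℕ × ℕ × ℕ =>
        t.1 * t.2.1 * t.2.2 ∈ Ioc 0 N ∧ Squarefree (t.1 * t.2.1 * t.2.2) ∧
        (t.1 % 2 = 1 ∧ t.1 % 4 = ε₁) ∧ (t.2.1 % 2 = 1 ∧ t.2.1 % 4 = ε₂) ∧
          (t.2.2 % 2 = 1 ∧ t.2.2 % 4 = ε₃) : Finset (ℕ × ℕ × ℕ)) := by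
    ext ⟨x, y, z⟩
    simp only [Set.mem_ofPred_eq, coe_filter, mem_product, mem_Ioc, hbound, Nat.odd_iff]
    constructor
    · rintro ⟨hx, hy, hz, ox, oy, oz, hs, ex, ey, ez, hle⟩
      have hxy : 0 < x * y := Nat.mul_pos hx hy
      have h1 : x * y ≤ N := (Nat.le_mul_of_pos_right _ hz).trans hle
      exact ⟨⟨⟨hx, (Nat.le_mul_of_pos_right _ hy).trans h1⟩,
        ⟨hy, (Nat.le_mul_of_pos_left _ hx).trans h1⟩,
        ⟨hz, (Nat.le_mul_of_pos_left _ hxy).trans hle⟩⟩,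
        ⟨Nat.mul_pos hxy hz, hle⟩, hs, ⟨ox, ex⟩, ⟨oy, ey⟩, oz, ez⟩
    · rintro ⟨⟨⟨hx, -⟩, ⟨hy, -⟩, hz, -⟩, ⟨-, hle⟩, hs, ⟨ox, ex⟩, ⟨oy, ey⟩, oz, ez⟩
      exact ⟨hx, hy, hz, ox, oy, oz, hs, ex, ey, ez, hle⟩
  rw [hset, Set.ncard_coe_finset, card_filter, Nat.cast_sum, squarefreeSum_apply, summatory]
  symm
  calc _ = ∑ n ∈ Ioc 0 N, ∑ t ∈ Ioc 0 N ×ˢ Ioc 0 N ×ˢ Ioc 0 N,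
        if t.1 * t.2.1 * t.2.2 = n then if Squarefree n then residueIndicator ε₁ t.1 *
          residueIndicator ε₂ t.2.1 * residueIndicator ε₃ t.2.2 else 0 else 0 := by
        refine sum_congr rfl fun n hn => ?_
        rw [squarefreePart_apply, mul_mul_apply_eq_sum_box _ _ _ hn]
        split_ifs <;> simp
    _ = _ := by
        rw [sum_comm]
        refine sum_congr rfl fun t _ => ?_
        rw [sum_ite_eq]
        simp only [residueIndicator_apply]
        by_cases hm : t.1 * t.2.1 * t.2.2 ∈ Ioc 0 N
        · by_cases hs : Squarefree (t.1 * t.2.1 * t.2.2)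
          · rw [if_pos hm, if_pos hs]
            split_ifs <;> simp_all
          · simp [hs]
        · rw [if_neg hm, if_neg fun h => hm h.1]
          simp

/-- for fixed `c ∈ {1,4,8}`, `μ, α, β ∈ {0,1}` with `μ+α+β ≤ 1` and residues
`ε₁, ε₂, ε₃ ∈ {1,3}` mod 4, the number `T(X)` of triples `(m₁,m₂,m₃)` of positive odd
integers with `m₁m₂m₃` squarefree, `mᵢ ≡ εᵢ (mod 4)` and `c·2^{μ+α+β}·m₁m₂m₃ ≤ √X`
satisfies `T(X) = √X (log X)²/(160 c 2^{μ+α+β}) ∏_p (1-1/p)³(1+3/p) + O(√X log X)`. -/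
theorem stmt_5 (c : ℕ) (hc : c ∈ ({1, 4, 8} : Set ℕ))
    (μ α β : ℕ) (hμ : μ ≤ 1) (hα : α ≤ 1) (hβ : β ≤ 1) (hsum : μ + α + β ≤ 1)
    (ε₁ ε₂ ε₃ : ℕ) (hε₁ : ε₁ ∈ ({1, 3} : Set ℕ)) (hε₂ : ε₂ ∈ ({1, 3} : Set ℕ))
    (hε₃ : ε₃ ∈ ({1, 3} : Set ℕ)) :
    (fun X : ℝ =>
        ((Set.ncard {t : ℕ × ℕ × ℕ |
            0 < t.1 ∧ 0 < t.2.1 ∧ 0 < t.2.2 ∧ Odd t.1 ∧ Odd t.2.1 ∧ Odd t.2.2 ∧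
            Squarefree (t.1 * t.2.1 * t.2.2) ∧
            t.1 % 4 = ε₁ ∧ t.2.1 % 4 = ε₂ ∧ t.2.2 % 4 = ε₃ ∧
            ((c * 2 ^ (μ + α + β) * (t.1 * t.2.1 * t.2.2) : ℕ) : ℝ) ≤ Real.sqrt X} : ℝ))
          - Real.sqrt X * Real.log X ^ 2 / (160 * c * 2 ^ (μ + α + β))
            * ∏' p : Nat.Primes, (1 - 1 / (p : ℝ)) ^ 3 * (1 + 3 / (p : ℝ)))
      =O[Filter.atTop] fun X : ℝ => Real.sqrt X * Real.log X := by
  obtain ⟨C, hC, hmain⟩ := exists_abs_squarefreeSum_residueIndicator_sub_le hε₁ hε₂ hε₃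
  have hc0 : 0 < c := by rcases hc with rfl | rfl | rfl <;> norm_num
  set K : ℕ := c * 2 ^ (μ + α + β) with hKdef
  have hK : 0 < K := by positivity
  have hK1 : (1 : ℝ) ≤ K := by exact_mod_cast hK
  set P := ∏' p : Nat.Primes, (1 - 1 / (p : ℝ)) ^ 3 * (1 + 3 / (p : ℝ))
  refine Asymptotics.IsBigO.of_bound (2 * C + K * |P| / 40) ?_
  filter_upwards [Filter.eventually_ge_atTop ((K : ℝ) ^ 2),
    Filter.eventually_ge_atTop (Real.exp 1)] with X hX hXe
  have hX0 : 0 < X := (Real.exp_pos 1).trans_le hXe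
  have hlX : 1 ≤ Real.log X := (Real.le_log_iff_exp_le hX0).2 hXe
  have hsq : (K : ℝ) ≤ √X := Real.le_sqrt_of_sq_le hX
  have hY : 1 ≤ √X / K := (one_le_div (by positivity)).2 hsq
  have hYle : √X / K ≤ √X := div_le_self (Real.sqrt_nonneg X) hK1
  have hlY : Real.log (√X / K) = Real.log X / 2 - Real.log K := by
    rw [Real.log_div (by linarith) (by positivity), Real.log_sqrt hX0.le]
  have hlK : 0 ≤ Real.log K := Real.log_nonneg hK1
  have hlKK : Real.log K ≤ K := (Real.log_le_sub_one_of_pos (by positivity)).trans (by linarith)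
  have hlY0 := Real.log_nonneg hY
  have hb := hmain _ hY
  rw [ncard_triples_eq_squarefreeSum ε₁ ε₂ ε₃ hK (Real.sqrt_nonneg X)]
  set S := squarefreeSum (√X / K) (residueIndicator ε₁ * residueIndicator ε₂ * residueIndicator ε₃)
  have hKc : (160 * c * 2 ^ (μ + α + β) : ℝ) = 160 * K := by
    rw [hKdef]
    push_cast
    ring
  rw [hKc, Real.norm_eq_abs, Real.norm_eq_abs,
    abs_of_nonneg (a := √X * Real.log X) (by positivity)]
  set Y := √X / K
  have hmid : |Y * Real.log Y ^ 2 / 40 * P - √X * Real.log X ^ 2 / (160 * K) * P| ≤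
      K * |P| / 40 * (√X * Real.log X) := by
    have e : Y * Real.log Y ^ 2 / 40 * P - √X * Real.log X ^ 2 / (160 * K) * P =
        Y * P / 40 * -(Real.log K * (Real.log X - Real.log K)) := by
      rw [hlY]
      simp only [Y]
      field_simp
      ring
    rw [e, abs_mul, abs_neg, abs_div, abs_mul, abs_of_nonneg (zero_le_one.trans hY),
      abs_of_nonneg (mul_nonneg hlK (by linarith : 0 ≤ Real.log X - Real.log K)),
      abs_of_nonneg (by norm_num : (0 : ℝ) ≤ 40)]
    calc _ ≤ √X * |P| / 40 * (K * Real.log X) := by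
          have h0 : 0 ≤ Real.log K * (Real.log X - Real.log K) :=
            mul_nonneg hlK (by linarith)
          have hstep : Real.log K * (Real.log X - Real.log K) ≤ K * Real.log X :=
            mul_le_mul hlKK (by linarith) (by linarith) (by positivity)
          exact mul_le_mul (by gcongr) hstep h0 (by positivity)
      _ = _ := by ring
  have hend : C * (Y * (1 + Real.log Y)) ≤ 2 * C * (√X * Real.log X) := by
    calc _ ≤ C * (√X * (2 * Real.log X)) := by
          gcongr
          linarith
      _ = _ := by ring
  calc _ = |(S - Y * Real.log Y ^ 2 / 40 * P) +
        (Y * Real.log Y ^ 2 / 40 * P - √X * Real.log X ^ 2 / (160 * K) * P)| := by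
        congr 1
        ring
    _ ≤ _ := (abs_add_le _ _).trans (by linarith)
end

section
/- Let τ₃(n) denote the number of ordered triples (m₁, m₂, m₃) of positive integers with m₁m₂m₃ = n. Then ∑_{n ≤ N, n odd} μ²(n)·τ₃(n) = (1/5)·∏_p (1 − 1/p)³(1 + 3/p) · N·(log N)² + O(N·log N), where the product runs over all primes p. -/
/-- The threefold divisor function: the number of ordered triples `(m₁, m₂, m₃)` of positive
integers with `m₁ * m₂ * m₃ = n`. -/
noncomputable def tauThree (n : ℕ) : ℕ :=
  Set.ncard {t : ℕ × ℕ × ℕ | 0 < t.1 ∧ 0 < t.2.1 ∧ 0 < t.2.2 ∧ t.1 * t.2.1 * t.2.2 = n}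

theorem sum_log_div_sub_sq_log {n : ℕ} (hn : 1 ≤ n) :
    |∑ d ∈ Finset.Ioc 0 n, Real.log d / d - Real.log n ^ 2 / 2| ≤ Real.log n := by
  induction n, hn using Nat.le_induction with
  | base => simp
  | succ n hn ih =>
    have hn0 : (0 : ℝ) < n := by exact_mod_cast hn
    rw [Finset.sum_Ioc_succ_top (Nat.zero_le n)]
    push_cast
    set S := ∑ d ∈ Finset.Ioc 0 n, Real.log d / d
    have hL0 : 0 ≤ Real.log n := Real.log_natCast_nonneg n
    have hlow : 1 / ((n : ℝ) + 1) ≤ Real.log (n + 1) - Real.log n := by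
      rw [← Real.log_div (by positivity) hn0.ne']
      have := Real.one_sub_inv_le_log_of_pos (x := ((n : ℝ) + 1) / n) (by positivity)
      convert! this using 1
      field_simp
      ring
    have hupp : Real.log (n + 1) - Real.log n ≤ 1 / n := by
      rw [← Real.log_div (by positivity) hn0.ne']
      have := Real.log_le_sub_one_of_pos (x := ((n : ℝ) + 1) / n) (by positivity)
      convert! this using 1
      field_simp
      ring
    have hM : Real.log ((n : ℝ) + 1) ≤ n := by
      simpa using Real.log_le_sub_one_of_pos (x := (n : ℝ) + 1) (by positivity)
    set L := Real.log n
    set M := Real.log ((n : ℝ) + 1)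
    have hδ0 : 0 ≤ M - L := le_trans (by positivity) hlow
    have hδ1 : M - L ≤ 1 := hupp.trans (by rw [div_le_one hn0]; exact_mod_cast hn)
    have h1 : M / (n + 1) ≤ (M - L) * M := by
      have := mul_le_mul_of_nonneg_right hlow (by linarith : 0 ≤ M)
      rwa [one_div_mul_eq_div] at this
    have h2 : (M - L) * M ≤ M / (n + 1) + (M - L) := by
      have a := mul_le_mul_of_nonneg_right hupp (by linarith : 0 ≤ M)
      have b : 1 / (n : ℝ) * M = M / (n + 1) + M / n * (1 / (n + 1)) := by field_simp
      have c : M / n * (1 / ((n : ℝ) + 1)) ≤ 1 * (1 / (n + 1)) :=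
        mul_le_mul_of_nonneg_right ((div_le_one hn0).2 hM) (by positivity)
      linarith
    rw [abs_le] at ih ⊢
    constructor <;> nlinarith

theorem log_sub_log_floor_le {x : ℝ} (hx : 1 ≤ x) :
    Real.log x - Real.log (⌊x⌋₊ : ℝ) ≤ 1 := by
  have h1 : (1 : ℝ) ≤ ⌊x⌋₊ := by exact_mod_cast Nat.one_le_floor_iff x |>.2 hx
  have h2 := Nat.lt_floor_add_one x
  rw [← Real.log_div (by positivity) (by positivity)]
  have h3 := Real.log_le_sub_one_of_pos (x := x / (⌊x⌋₊ : ℝ)) (by positivity)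
  have h4 : x / (⌊x⌋₊ : ℝ) ≤ 2 := by
    rw [div_le_iff₀ (by positivity)]; linarith
  linarith

theorem sum_floor_log_div_sub_sq_log {x : ℝ} (hx : 1 ≤ x) :
    |∑ d ∈ Finset.Ioc 0 ⌊x⌋₊, Real.log d / d - Real.log x ^ 2 / 2| ≤ 2 * Real.log x := by
  have h1 : 1 ≤ ⌊x⌋₊ := Nat.one_le_floor_iff x |>.2 hx
  have h := sum_log_div_sub_sq_log h1
  have h2 := log_sub_log_floor_le hx
  have h3 : Real.log (⌊x⌋₊ : ℝ) ≤ Real.log x :=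
    Real.log_le_log (by exact_mod_cast h1) (Nat.floor_le (by linarith))
  have h4 : 0 ≤ Real.log (⌊x⌋₊ : ℝ) := Real.log_natCast_nonneg _
  rw [abs_le] at h ⊢
  constructor <;> nlinarith

theorem sum_floor_inv_sub_log {x : ℝ} (hx : 1 ≤ x) :
    |∑ d ∈ Finset.Ioc 0 ⌊x⌋₊, (d : ℝ)⁻¹ - Real.log x| ≤ 1 := by
  have h : ((harmonic ⌊x⌋₊ : ℚ) : ℝ) = ∑ d ∈ Finset.Ioc 0 ⌊x⌋₊, (d : ℝ)⁻¹ := by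
    rw [harmonic_eq_sum_Icc]
    push_cast
    rfl
  rw [← h, abs_le]
  constructor
  · linarith [log_le_harmonic_floor x (by linarith)]
  · linarith [harmonic_floor_le_one_add_log x hx]

open ArithmeticFunction ArithmeticFunction.zeta ArithmeticFunction.Moebius

theorem sum_Ioc_floor_mul (f g : ArithmeticFunction ℝ) (x : ℝ) :
    ∑ n ∈ Finset.Ioc 0 ⌊x⌋₊, (f * g) n =
      ∑ d ∈ Finset.Ioc 0 ⌊x⌋₊, f d * ∑ m ∈ Finset.Ioc 0 ⌊x / d⌋₊, g m := by
  simp_rw [sum_Ioc_mul_eq_sum_sum, Nat.floor_div_natCast]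

theorem one_le_div_of_mem_Ioc_floor_s6 {x : ℝ} {d : ℕ} (hd : d ∈ Finset.Ioc 0 ⌊x⌋₊) :
    0 < (d : ℝ) ∧ 1 ≤ x / d := by
  rw [Finset.mem_Ioc] at hd
  have h0 : (0 : ℝ) < d := by exact_mod_cast hd.1
  refine ⟨h0, (one_le_div h0).2 ?_⟩
  exact (Nat.le_floor_iff' hd.1.ne').1 hd.2

theorem sum_floor_zeta_mul_zeta {x : ℝ} (hx : 1 ≤ x) :
    |∑ n ∈ Finset.Ioc 0 ⌊x⌋₊, ((ζ : ArithmeticFunction ℝ) * (ζ : ArithmeticFunction ℝ)) n -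
      x * Real.log x| ≤ 2 * x := by
  have key : |∑ n ∈ Finset.Ioc 0 ⌊x⌋₊, ((ζ : ArithmeticFunction ℝ) * (ζ : ArithmeticFunction ℝ)) n -
      x * ∑ d ∈ Finset.Ioc 0 ⌊x⌋₊, (d : ℝ)⁻¹| ≤ x := by
    rw [sum_Ioc_mul_zeta_eq_sum, Finset.mul_sum, ← Finset.sum_sub_distrib]
    refine (Finset.abs_sum_le_sum_abs _ _).trans ?_
    calc _ ≤ ∑ d ∈ Finset.Ioc 0 ⌊x⌋₊, (1 : ℝ) := by
          refine Finset.sum_le_sum fun d hd => ?_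
          obtain ⟨h0, h1⟩ := one_le_div_of_mem_Ioc_floor_s6 hd
          have hd0 : d ≠ 0 := by rintro rfl; simp at h0
          rw [← Nat.floor_div_natCast, natCoe_apply, zeta_apply_ne hd0, ← div_eq_mul_inv, abs_le]
          have := Nat.floor_le (by linarith : 0 ≤ x / d)
          have := Nat.lt_floor_add_one (x / d)
          push_cast
          constructor <;> linarith
      _ ≤ x := by simpa using Nat.floor_le (by linarith)
  have h2 := sum_floor_inv_sub_log hx
  rw [abs_le] at key h2 ⊢
  constructor <;> nlinarith

theorem sum_floor_zeta_mul_zeta_mul_zeta {x : ℝ} (hx : 1 ≤ x) :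
    |∑ n ∈ Finset.Ioc 0 ⌊x⌋₊,
      ((ζ : ArithmeticFunction ℝ) * ((ζ : ArithmeticFunction ℝ) * (ζ : ArithmeticFunction ℝ))) n -
      x * Real.log x ^ 2 / 2| ≤ 5 * (x * (1 + Real.log x)) := by
  rw [sum_Ioc_floor_mul]
  have h1 := sum_floor_inv_sub_log hx
  have h2 := sum_floor_log_div_sub_sq_log hx
  set H := ∑ d ∈ Finset.Ioc 0 ⌊x⌋₊, (d : ℝ)⁻¹ with hH
  set S := ∑ d ∈ Finset.Ioc 0 ⌊x⌋₊, Real.log d / d with hS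
  have key : |∑ d ∈ Finset.Ioc 0 ⌊x⌋₊, (ζ : ArithmeticFunction ℝ) d * ∑ m ∈ Finset.Ioc 0 ⌊x / d⌋₊,
      ((ζ : ArithmeticFunction ℝ) * (ζ : ArithmeticFunction ℝ)) m -
      x * (Real.log x * H - S)| ≤ 2 * x * H := by
    rw [hH, hS, Finset.mul_sum, ← Finset.sum_sub_distrib, Finset.mul_sum, Finset.mul_sum,
      ← Finset.sum_sub_distrib]
    refine (Finset.abs_sum_le_sum_abs _ _).trans (Finset.sum_le_sum fun d hd => ?_)
    obtain ⟨h0, h1⟩ := one_le_div_of_mem_Ioc_floor_s6 hd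
    have hd0 : d ≠ 0 := by rintro rfl; simp at h0
    have := sum_floor_zeta_mul_zeta h1
    rw [Real.log_div (by positivity) h0.ne'] at this
    rw [natCoe_apply, zeta_apply_ne hd0, Nat.cast_one, one_mul]
    convert! this using 1
    · congr 1
      field_simp
    · ring
  have hx0 : 0 < x := by linarith
  have hl : 0 ≤ Real.log x := Real.log_nonneg hx
  rw [abs_le] at key h1 h2 ⊢
  have e1 : x * H ≤ x * (1 + Real.log x) := mul_le_mul_of_nonneg_left (by linarith) hx0.le
  have e2 : |x * (Real.log x * H - S) - x * Real.log x ^ 2 / 2| ≤ 3 * (x * Real.log x) := by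
    have : x * (Real.log x * H - S) - x * Real.log x ^ 2 / 2 =
      x * (Real.log x * (H - Real.log x) - (S - Real.log x ^ 2 / 2)) := by ring
    rw [this, abs_mul, abs_of_pos hx0]
    have : |Real.log x * (H - Real.log x) - (S - Real.log x ^ 2 / 2)| ≤ 3 * Real.log x := by
      rw [abs_le]
      constructor <;> nlinarith
    nlinarith
  rw [abs_le] at e2
  constructor <;> nlinarith

theorem tauThree_eq_zeta_mul (n : ℕ) : tauThree n = (ζ * (ζ * ζ)) n := by
  have h1 : (ζ * (ζ * ζ)) n = (n.divisorsAntidiagonal.sigma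
      fun d => d.2.divisorsAntidiagonal).card := by
    rw [Finset.card_sigma, mul_apply]
    refine Finset.sum_congr rfl fun d hd => ?_
    have hd' := Nat.mem_divisorsAntidiagonal.1 hd
    have hd1 : d.1 ≠ 0 := by rintro h; simp [h] at hd'; omega
    rw [zeta_apply_ne hd1, one_mul, mul_apply, Finset.card_eq_sum_ones]
    refine Finset.sum_congr rfl fun e he => ?_
    have he' := Nat.mem_divisorsAntidiagonal.1 he
    have he1 : e.1 ≠ 0 := by rintro h; simp [h] at he'; omega
    have he2 : e.2 ≠ 0 := by rintro h; simp [h] at he'; omega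
    rw [zeta_apply_ne he1, zeta_apply_ne he2, mul_one]
  rw [h1, tauThree, ← Set.ncard_coe_finset]
  refine Set.ncard_congr (fun t _ => ⟨(t.1, t.2.1 * t.2.2), (t.2.1, t.2.2)⟩) ?_ ?_ ?_
  · rintro ⟨a, b, c⟩ ⟨ha, hb, hc, rfl⟩
    simp only at ha hb hc
    simp [ha.ne', hb.ne', hc.ne', mul_assoc]
  · rintro ⟨a, b, c⟩ ⟨a', b', c'⟩ _ _ h
    simp at h
    simp [h]
  · rintro ⟨⟨a, m⟩, ⟨b, c⟩⟩ h
    simp only [Finset.coe_sigma, Set.mem_sigma_iff, Finset.mem_coe,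
      Nat.mem_divisorsAntidiagonal] at h
    obtain ⟨⟨rfl, h0⟩, rfl, h1⟩ := h
    refine ⟨(a, b, c), ?_, rfl⟩
    simp only [ne_eq, mul_eq_zero, not_or] at h0
    simp only [Set.mem_ofPred_eq]
    refine ⟨?_, ?_, ?_, by ring⟩ <;> omega

theorem mul_zeta_apply_prime_pow {R : Type*} [Semiring R] (g : ArithmeticFunction R) {p : ℕ}
    (hp : p.Prime) (k : ℕ) :
    (g * (ζ : ArithmeticFunction R)) (p ^ k) = ∑ i ∈ Finset.range (k + 1), g (p ^ i) := by
  rw [coe_mul_zeta_apply, Nat.sum_divisors_prime_pow hp]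

theorem mul_moebius_apply_prime_pow_succ (g : ArithmeticFunction ℝ) {p : ℕ} (hp : p.Prime)
    (k : ℕ) :
    (g * (μ : ArithmeticFunction ℝ)) (p ^ (k + 1)) = g (p ^ (k + 1)) - g (p ^ k) := by
  have hg : g * (μ : ArithmeticFunction ℝ) * (ζ : ArithmeticFunction ℝ) = g := by
    rw [mul_assoc, coe_moebius_mul_coe_zeta, mul_one]
  have h := mul_zeta_apply_prime_pow (g * (μ : ArithmeticFunction ℝ)) hp
  rw [hg] at h
  rw [h (k + 1), h k, Finset.sum_range_succ _ (k + 1)]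
  ring

theorem tauThree_prime {p : ℕ} (hp : p.Prime) : tauThree p = 3 := by
  have h2 : (ζ * ζ) p = 2 := by
    have := mul_zeta_apply_prime_pow ζ hp 1
    rw [natCoe_nat, pow_one] at this
    simp [this, hp.ne_zero]
  have := mul_zeta_apply_prime_pow (ζ * ζ) hp 1
  rw [natCoe_nat, pow_one] at this
  rw [tauThree_eq_zeta_mul, mul_comm, this]
  rw [Finset.sum_range_succ, Finset.sum_range_one, pow_zero, pow_one, h2,
    (isMultiplicative_zeta.mul isMultiplicative_zeta).map_one]

/-- The arithmetic function `n ↦ τ₃(n)` restricted to odd squarefree integers. -/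
noncomputable def oddSquarefreeTauThree : ArithmeticFunction ℝ where
  toFun n := if Odd n ∧ Squarefree n then (tauThree n : ℝ) else 0
  map_zero' := by simp

theorem oddSquarefreeTauThree_apply (n : ℕ) :
    oddSquarefreeTauThree n = if Odd n ∧ Squarefree n then (tauThree n : ℝ) else 0 := rfl

theorem isMultiplicative_oddSquarefreeTauThree : oddSquarefreeTauThree.IsMultiplicative := by
  have hZ : (ζ * (ζ * ζ)).IsMultiplicative :=
    isMultiplicative_zeta.mul (isMultiplicative_zeta.mul isMultiplicative_zeta)
  refine ⟨?_, fun {m n} hmn => ?_⟩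
  · simp [oddSquarefreeTauThree_apply, tauThree_eq_zeta_mul]
  · simp only [oddSquarefreeTauThree_apply, tauThree_eq_zeta_mul, Nat.odd_mul,
      Nat.squarefree_mul hmn, hZ.map_mul_of_coprime hmn]
    split_ifs <;> first | tauto | simp

theorem oddSquarefreeTauThree_prime {p : ℕ} (hp : p.Prime) :
    oddSquarefreeTauThree p = if p = 2 then 0 else 3 := by
  rw [oddSquarefreeTauThree_apply]
  split_ifs with h h2 h2
  · subst h2; exact absurd h.1 (by decide)
  · simp [tauThree_prime hp]
  · rfl
  · exact absurd ⟨hp.odd_of_ne_two h2, hp.prime.squarefree⟩ h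

theorem oddSquarefreeTauThree_prime_pow {p : ℕ} (hp : p.Prime) (k : ℕ) :
    oddSquarefreeTauThree (p ^ (k + 2)) = 0 := by
  rw [oddSquarefreeTauThree_apply, if_neg]
  rintro ⟨-, h⟩
  have := (Nat.squarefree_pow_iff hp.ne_one (by omega : k + 2 ≠ 0)).1 h
  omega

/-- The quotient of `oddSquarefreeTauThree` by `τ₃` for Dirichlet convolution. -/
noncomputable def tauThreeQuotient : ArithmeticFunction ℝ :=
  oddSquarefreeTauThree * (μ : ArithmeticFunction ℝ) * (μ : ArithmeticFunction ℝ) *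
    (μ : ArithmeticFunction ℝ)

theorem tauThreeQuotient_mul_zeta :
    tauThreeQuotient * ((ζ : ArithmeticFunction ℝ) *
      ((ζ : ArithmeticFunction ℝ) * (ζ : ArithmeticFunction ℝ))) = oddSquarefreeTauThree := by
  have h : (μ : ArithmeticFunction ℝ) * (ζ : ArithmeticFunction ℝ) = 1 :=
    coe_moebius_mul_coe_zeta
  calc _ = oddSquarefreeTauThree * ((μ : ArithmeticFunction ℝ) * (ζ : ArithmeticFunction ℝ)) *
        ((μ : ArithmeticFunction ℝ) * (ζ : ArithmeticFunction ℝ)) *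
        ((μ : ArithmeticFunction ℝ) * (ζ : ArithmeticFunction ℝ)) := by
          rw [tauThreeQuotient]; ring
    _ = _ := by simp only [h, mul_one]

theorem isMultiplicative_tauThreeQuotient : tauThreeQuotient.IsMultiplicative :=
  have h := isMultiplicative_moebius.intCast (R := ℝ)
  ((isMultiplicative_oddSquarefreeTauThree.mul h).mul h).mul h

theorem tauThreeQuotient_prime_pow {p : ℕ} (hp : p.Prime) :
    tauThreeQuotient p = oddSquarefreeTauThree p - 3 ∧
    tauThreeQuotient (p ^ 2) = 3 - 3 * oddSquarefreeTauThree p ∧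
    tauThreeQuotient (p ^ 3) = 3 * oddSquarefreeTauThree p - 1 ∧
    tauThreeQuotient (p ^ 4) = - oddSquarefreeTauThree p ∧
    ∀ k, tauThreeQuotient (p ^ (k + 5)) = 0 := by
  have h0 : oddSquarefreeTauThree (p ^ 0) = 1 := by
    rw [pow_zero, isMultiplicative_oddSquarefreeTauThree.map_one]
  have hμ := isMultiplicative_moebius.intCast (R := ℝ)
  have hk := oddSquarefreeTauThree_prime_pow hp
  set f := oddSquarefreeTauThree
  have hm := isMultiplicative_oddSquarefreeTauThree
  have a0 : (f * (μ : ArithmeticFunction ℝ)) (p ^ 0) = 1 := by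
    rw [pow_zero, (hm.mul hμ).map_one]
  have b0 : (f * (μ : ArithmeticFunction ℝ) * (μ : ArithmeticFunction ℝ)) (p ^ 0) = 1 := by
    rw [pow_zero, ((hm.mul hμ).mul hμ).map_one]
  have a := mul_moebius_apply_prime_pow_succ f hp
  have b := mul_moebius_apply_prime_pow_succ (f * (μ : ArithmeticFunction ℝ)) hp
  have c := mul_moebius_apply_prime_pow_succ
    (f * (μ : ArithmeticFunction ℝ) * (μ : ArithmeticFunction ℝ)) hp
  have p1 : p = p ^ (0 + 1) := by simp
  have h1 : f (p ^ (0 + 1)) = f p := by simp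
  have h2 : f (p ^ (1 + 1)) = 0 := hk 0
  have h3 : f (p ^ (2 + 1)) = 0 := hk 1
  have h4 : f (p ^ (3 + 1)) = 0 := hk 2
  refine ⟨?_, ?_, ?_, ?_, fun k => ?_⟩
  · conv_lhs => rw [p1]
    rw [tauThreeQuotient, c, b, a, h1, h0, a0, b0]; ring
  · rw [tauThreeQuotient, c 1, b 1, b 0, a 1, a 0, h2, h1, h0, a0]; ring
  · rw [tauThreeQuotient, c 2, b 2, b 1, a 2, a 1, a 0, h3, h2, h1, h0]; ring
  · rw [tauThreeQuotient, c 3, b 3, b 2, a 3, a 2, a 1, h4, h3, h2, h1]; ring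
  · rw [tauThreeQuotient, c (k + 4), b (k + 4), b (k + 3), a (k + 4), a (k + 3), a (k + 2),
      hk (k + 3), hk (k + 2), hk (k + 1), hk k]; ring

theorem summable_of_multiplicative_of_tsum_prime_pow_le {g b : ℕ → ℝ} (hg : ∀ n, 0 ≤ g n)
    (hg0 : g 0 = 0) (hg1 : g 1 = 1) (hmul : ∀ {m n : ℕ}, m.Coprime n → g (m * n) = g m * g n)
    (hb : ∀ n, 0 ≤ b n) (hbs : Summable b)
    (hs : ∀ {p : ℕ}, p.Prime → Summable fun k => g (p ^ k))
    (hle : ∀ {p : ℕ}, p.Prime → ∑' k, g (p ^ k) ≤ 1 + b p) : Summable g := by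
  refine summable_of_sum_le (c := Real.exp (∑' n, b n)) hg fun u => ?_
  set N := u.sup id + 1
  have h := (EulerProduct.summable_and_hasSum_smoothNumbers_prod_primesBelow_tsum hg1 hmul
    (fun hp => (hs hp).norm) N).2
  have h' : HasSum (Set.indicator N.smoothNumbers g) _ := hasSum_subtype_iff_indicator.1 h
  calc ∑ n ∈ u, g n = ∑ n ∈ u, Set.indicator N.smoothNumbers g n := by
        refine Finset.sum_congr rfl fun n hn => ?_
        rcases Nat.eq_zero_or_pos n with rfl | hpos
        · by_cases h0 : 0 ∈ N.smoothNumbers <;> simp [h0, hg0]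
        · have : n ≤ u.sup id := Finset.le_sup (f := id) hn
          rw [Set.indicator_of_mem (Nat.mem_smoothNumbers_of_lt hpos (by omega))]
    _ ≤ ∏ p ∈ N.primesBelow, ∑' k, g (p ^ k) :=
        sum_le_hasSum u (fun n _ => Set.indicator_nonneg (fun n _ => hg n) n) h'
    _ ≤ ∏ p ∈ N.primesBelow, (1 + b p) :=
        Finset.prod_le_prod (fun p _ => tsum_nonneg fun k => hg _)
          fun p hp => hle (Nat.prime_of_mem_primesBelow hp)
    _ ≤ Real.exp (∑ p ∈ N.primesBelow, b p) :=
        Real.prod_one_add_le_exp_sum _ hb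
    _ ≤ Real.exp (∑' n, b n) :=
        Real.exp_le_exp.2 (hbs.sum_le_tsum _ fun n _ => hb n)

theorem tauThreeQuotient_apply_prime {p : ℕ} (hp : p.Prime) :
    tauThreeQuotient p = if p = 2 then -3 else 0 := by
  rw [(tauThreeQuotient_prime_pow hp).1, oddSquarefreeTauThree_prime hp]
  split_ifs <;> norm_num

theorem abs_tauThreeQuotient_prime_pow_le {p : ℕ} (hp : p.Prime) (k : ℕ) :
    |tauThreeQuotient (p ^ (k + 1))| ≤ 8 := by
  obtain ⟨h1, h2, h3, h4, h5⟩ := tauThreeQuotient_prime_pow hp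
  have hf : |oddSquarefreeTauThree p - 3 / 2| ≤ 3 / 2 := by
    rw [oddSquarefreeTauThree_prime hp]
    split_ifs <;> norm_num [abs_le]
  rw [abs_le] at hf ⊢
  match k with
  | 0 => rw [zero_add, pow_one, h1]; constructor <;> linarith
  | 1 => rw [h2]; constructor <;> linarith
  | 2 => rw [h3]; constructor <;> linarith
  | 3 => rw [h4]; constructor <;> linarith
  | k + 4 => rw [h5]; norm_num

theorem hasSum_tauThreeQuotient_prime_pow_mul {p : ℕ} (hp : p.Prime) (w : ℕ → ℝ) (φ : ℝ → ℝ)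
    (hφ : φ 0 = 0) :
    HasSum (fun k => φ (tauThreeQuotient (p ^ k)) * w k)
      (∑ k ∈ Finset.range 5, φ (tauThreeQuotient (p ^ k)) * w k) := by
  refine hasSum_sum_of_ne_finset_zero fun k hk => ?_
  rw [Finset.mem_range, not_lt] at hk
  obtain ⟨j, rfl⟩ := Nat.exists_eq_add_of_le' hk
  rw [(tauThreeQuotient_prime_pow hp).2.2.2.2 j, hφ, zero_mul]

theorem summable_abs_tauThreeQuotient_mul_rpow :
    Summable fun n : ℕ => |tauThreeQuotient n| * (n : ℝ) ^ (-(3 / 4) : ℝ) := by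
  have hsum : ∀ {p : ℕ}, p.Prime → HasSum
      (fun k => |tauThreeQuotient (p ^ k)| * ((p ^ k : ℕ) : ℝ) ^ (-(3 / 4) : ℝ))
      (∑ k ∈ Finset.range 5, |tauThreeQuotient (p ^ k)| * ((p ^ k : ℕ) : ℝ) ^ (-(3 / 4) : ℝ)) :=
    fun hp => hasSum_tauThreeQuotient_prime_pow_mul hp _ _ abs_zero
  refine summable_of_multiplicative_of_tsum_prime_pow_le
    (b := fun n => 72 * (n : ℝ) ^ (-(3 / 2) : ℝ)) (fun n => by positivity) (by simp)
    (by simp [isMultiplicative_tauThreeQuotient.map_one]) (fun {m n} hmn => ?_)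
    (fun n => by positivity) ((Real.summable_nat_rpow.2 (by norm_num)).mul_left _)
    (fun hp => (hsum hp).summable) (fun {p} hp => ?_)
  · rw [isMultiplicative_tauThreeQuotient.map_mul_of_coprime hmn, abs_mul, Nat.cast_mul,
      Real.mul_rpow (by positivity) (by positivity)]
    ring
  · have hp1 : (1 : ℝ) ≤ p := by exact_mod_cast hp.one_lt.le
    have hterm : ∀ k, |tauThreeQuotient (p ^ (k + 1))| *
        ((p ^ (k + 1) : ℕ) : ℝ) ^ (-(3 / 4) : ℝ) ≤ 18 * (p : ℝ) ^ (-(3 / 2) : ℝ) := by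
      intro k
      rcases Nat.eq_zero_or_pos k with rfl | hk
      · rw [zero_add, pow_one, tauThreeQuotient_apply_prime hp]
        split_ifs with h2
        · subst h2
          have : ((2 : ℕ) : ℝ) ^ (-(3 / 4) : ℝ) ≤ 2 * ((2 : ℕ) : ℝ) ^ (-(3 / 2) : ℝ) := by
            push_cast
            rw [← Real.rpow_one_add' (by norm_num) (by norm_num)]
            exact Real.rpow_le_rpow_of_exponent_le (by norm_num) (by norm_num)
          have h3 : (0 : ℝ) ≤ ((2 : ℕ) : ℝ) ^ (-(3 / 2) : ℝ) := by positivity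
          rw [abs_neg, abs_of_pos three_pos]
          linarith
        · rw [abs_zero, zero_mul]; positivity
      · have h1 : ((p ^ (k + 1) : ℕ) : ℝ) ^ (-(3 / 4) : ℝ) ≤ (p : ℝ) ^ (-(3 / 2) : ℝ) := by
          rw [Nat.cast_pow, ← Real.rpow_natCast, ← Real.rpow_mul (by positivity)]
          refine Real.rpow_le_rpow_of_exponent_le hp1 ?_
          have : (1 : ℝ) ≤ k := by exact_mod_cast hk
          push_cast
          linarith
        exact mul_le_mul ((abs_tauThreeQuotient_prime_pow_le hp k).trans (by norm_num)) h1
          (by positivity) (by norm_num)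
    rw [(hsum hp).tsum_eq, Finset.sum_range_succ', add_comm]
    refine add_le_add ?_ ?_
    · simp [isMultiplicative_tauThreeQuotient.map_one]
    · refine (Finset.sum_le_sum fun k _ => hterm k).trans ?_
      rw [Finset.sum_const, Finset.card_range, nsmul_eq_mul]
      apply le_of_eq; push_cast; ring

theorem summable_abs_tauThreeQuotient_mul_log :
    Summable fun n : ℕ => |tauThreeQuotient n| / n * (1 + Real.log n) := by
  refine Summable.of_nonneg_of_le
    (fun n => mul_nonneg (by positivity) (by linarith [Real.log_natCast_nonneg n]))
    (fun n => ?_) (summable_abs_tauThreeQuotient_mul_rpow.mul_left 5)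
  rcases Nat.eq_zero_or_pos n with rfl | hn
  · simp
  have hn1 : (1 : ℝ) ≤ n := by exact_mod_cast hn
  have hlog := Real.log_le_rpow_div (x := n) (by positivity) (ε := 1 / 4) (by norm_num)
  have h1 : (1 : ℝ) ≤ (n : ℝ) ^ (1 / 4 : ℝ) := Real.one_le_rpow hn1 (by norm_num)
  have h2 : (n : ℝ) ^ (-(3 / 4) : ℝ) = (n : ℝ)⁻¹ * (n : ℝ) ^ (1 / 4 : ℝ) := by
    rw [← Real.rpow_neg_one, ← Real.rpow_add (by positivity)]
    norm_num
  rw [h2]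
  calc _ ≤ |tauThreeQuotient n| / n * (5 * (n : ℝ) ^ (1 / 4 : ℝ)) :=
        mul_le_mul_of_nonneg_left (by linarith) (by positivity)
    _ = _ := by ring

theorem summable_abs_tauThreeQuotient_div :
    Summable fun n : ℕ => |tauThreeQuotient n / n| := by
  refine Summable.of_nonneg_of_le (fun n => abs_nonneg _) (fun n => ?_)
    summable_abs_tauThreeQuotient_mul_log
  rw [abs_div, Nat.abs_cast]
  exact le_mul_of_one_le_right (by positivity) (by linarith [Real.log_natCast_nonneg n])

theorem tsum_tauThreeQuotient_prime_pow_div {p : ℕ} (hp : p.Prime) :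
    ∑' k, tauThreeQuotient (p ^ k) / (p ^ k : ℕ) =
      (1 - 1 / (p : ℝ)) ^ 3 * (1 + oddSquarefreeTauThree p / p) := by
  have h := (hasSum_tauThreeQuotient_prime_pow_mul hp (fun k => ((p ^ k : ℕ) : ℝ)⁻¹) id rfl).tsum_eq
  simp only [id, ← div_eq_mul_inv] at h
  obtain ⟨h1, h2, h3, h4, -⟩ := tauThreeQuotient_prime_pow hp
  have hp0 : (p : ℝ) ≠ 0 := by exact_mod_cast hp.ne_zero
  rw [h]
  simp only [Finset.sum_range_succ, Finset.sum_range_zero, pow_zero, pow_one, h1, h2, h3, h4,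
    isMultiplicative_tauThreeQuotient.map_one]
  push_cast
  field_simp
  ring

theorem tsum_tauThreeQuotient_div :
    ∑' n : ℕ, tauThreeQuotient n / n =
      2 / 5 * ∏' p : Nat.Primes, (1 - 1 / (p : ℝ)) ^ 3 * (1 + 3 / (p : ℝ)) := by
  have hprod : HasProd (fun p : Nat.Primes => ∑' k, tauThreeQuotient (p ^ k) / ((p : ℕ) ^ k : ℕ))
      (∑' n : ℕ, tauThreeQuotient n / n) := by
    refine EulerProduct.eulerProduct_hasProd (f := fun n : ℕ => tauThreeQuotient n / n)
      (by simp [isMultiplicative_tauThreeQuotient.map_one]) (fun {m n} hmn => ?_)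
      summable_abs_tauThreeQuotient_div (by simp)
    rw [isMultiplicative_tauThreeQuotient.map_mul_of_coprime hmn, Nat.cast_mul, mul_div_mul_comm]
  have htwo : HasProd (fun p : Nat.Primes => if (p : ℕ) = 2 then (5 / 2 : ℝ) else 1) (5 / 2) := by
    simpa using hasProd_single (f := fun p : Nat.Primes => if (p : ℕ) = 2 then (5 / 2 : ℝ) else 1)
      ⟨2, Nat.prime_two⟩ fun p hp => if_neg fun h => hp (Subtype.ext h)
  have heq : ∀ p : Nat.Primes, (∑' k, tauThreeQuotient (p ^ k) / ((p : ℕ) ^ k : ℕ)) *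
      (if (p : ℕ) = 2 then (5 / 2 : ℝ) else 1) =
      (1 - 1 / (p : ℝ)) ^ 3 * (1 + 3 / (p : ℝ)) := by
    rintro ⟨p, hp⟩
    rw [tsum_tauThreeQuotient_prime_pow_div hp, oddSquarefreeTauThree_prime hp]
    by_cases h2 : p = 2
    · subst h2; norm_num
    · simp [h2]
  rw [← tprod_congr heq, (hprod.mul htwo).tprod_eq]
  ring

theorem abs_sum_floor_mul_sub_le {h g : ArithmeticFunction ℝ} {C : ℝ} (hC : 0 ≤ C)
    (hg : ∀ x : ℝ, 1 ≤ x → |∑ n ∈ Finset.Ioc 0 ⌊x⌋₊, g n - x * Real.log x ^ 2 / 2| ≤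
      C * (x * (1 + Real.log x)))
    (hh : Summable fun n : ℕ => |h n| / n * (1 + Real.log n))
    (hh' : Summable fun n : ℕ => |h n / n|) {x : ℝ} (hx : 1 ≤ x) :
    |∑ n ∈ Finset.Ioc 0 ⌊x⌋₊, (h * g) n - x * Real.log x ^ 2 / 2 * ∑' n : ℕ, h n / n| ≤
      (C + 1) * (∑' n : ℕ, |h n| / n * (1 + Real.log n)) * (x * (1 + Real.log x)) := by
  have hx0 : 0 < x := by linarith
  have hlx : 0 ≤ Real.log x := Real.log_nonneg hx
  have hsupp : ∀ n ∉ Finset.Ioc 0 ⌊x⌋₊, h n * ∑ m ∈ Finset.Ioc 0 ⌊x / n⌋₊, g m = 0 := by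
    intro n hn
    rcases Nat.eq_zero_or_pos n with rfl | hpos
    · simp
    · have : ⌊x / n⌋₊ = 0 := by
        rw [Nat.floor_div_natCast, Nat.div_eq_zero_iff]
        rw [Finset.mem_Ioc] at hn
        omega
      simp [this]
  have hs : HasSum (fun n : ℕ => h n * ∑ m ∈ Finset.Ioc 0 ⌊x / n⌋₊, g m)
      (∑ n ∈ Finset.Ioc 0 ⌊x⌋₊, (h * g) n) := by
    rw [sum_Ioc_floor_mul]
    exact hasSum_sum_of_ne_finset_zero hsupp
  have hs' := hs.sub (hh'.of_abs.hasSum.mul_left (x * Real.log x ^ 2 / 2))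
  rw [← hs'.tsum_eq, ← Real.norm_eq_abs, mul_right_comm, ← tsum_mul_left]
  refine tsum_of_norm_bounded (hh.mul_left _).hasSum fun n => ?_
  rw [Real.norm_eq_abs]
  rcases Nat.eq_zero_or_pos n with rfl | hpos
  · simp
  have hn0 : (0 : ℝ) < n := by exact_mod_cast hpos
  have hln : 0 ≤ Real.log n := Real.log_natCast_nonneg n
  have hfac : h n * ∑ m ∈ Finset.Ioc 0 ⌊x / n⌋₊, g m - x * Real.log x ^ 2 / 2 * (h n / n) =
      h n * (∑ m ∈ Finset.Ioc 0 ⌊x / n⌋₊, g m - x / n * Real.log x ^ 2 / 2) := by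
    field_simp
  have hbound : |∑ m ∈ Finset.Ioc 0 ⌊x / n⌋₊, g m - x / n * Real.log x ^ 2 / 2| ≤
      (C + 1) * (x * (1 + Real.log x)) * ((n : ℝ)⁻¹ * (1 + Real.log n)) := by
    have hrw : (C + 1) * (x * (1 + Real.log x)) * ((n : ℝ)⁻¹ * (1 + Real.log n)) =
        x / n * ((C + 1) * ((1 + Real.log x) * (1 + Real.log n))) := by
      field_simp
    rw [hrw]
    have hxn : 0 < x / n := by positivity
    have hprod : 0 ≤ Real.log x * Real.log n := mul_nonneg hlx hln
    rcases le_or_gt (n : ℝ) x with hnx | hnx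
    · have h1 := hg (x / n) ((one_le_div hn0).2 hnx)
      rw [Real.log_div hx0.ne' hn0.ne'] at h1
      have hlnx : Real.log n ≤ Real.log x := Real.log_le_log hn0 hnx
      have h2 : |x / n * (Real.log x - Real.log n) ^ 2 / 2 - x / n * Real.log x ^ 2 / 2| ≤
          x / n * (Real.log x * Real.log n) := by
        have : x / n * (Real.log x - Real.log n) ^ 2 / 2 - x / n * Real.log x ^ 2 / 2 =
          x / n * (((Real.log x - Real.log n) ^ 2 - Real.log x ^ 2) / 2) := by ring
        rw [this, abs_mul, abs_of_pos hxn]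
        refine mul_le_mul_of_nonneg_left ?_ hxn.le
        rw [abs_le]
        constructor <;> nlinarith
      refine (abs_sub_le _ _ _).trans ((add_le_add h1 h2).trans ?_)
      have h3 : C * (1 + (Real.log x - Real.log n)) + Real.log x * Real.log n ≤
          (C + 1) * ((1 + Real.log x) * (1 + Real.log n)) := by
        nlinarith [mul_nonneg hC hprod, mul_nonneg hC hln]
      calc _ = x / n * (C * (1 + (Real.log x - Real.log n)) + Real.log x * Real.log n) := by ring
        _ ≤ _ := mul_le_mul_of_nonneg_left h3 hxn.le
    · have hfl : ⌊x / n⌋₊ = 0 := Nat.floor_eq_zero.2 ((div_lt_one hn0).2 hnx)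
      have hlnx : Real.log x ≤ Real.log n := Real.log_le_log hx0 hnx.le
      rw [hfl, Finset.Ioc_self, Finset.sum_empty, zero_sub, abs_neg, abs_of_nonneg (by positivity),
        mul_div_assoc]
      refine mul_le_mul_of_nonneg_left ?_ hxn.le
      nlinarith [mul_nonneg hC hprod, mul_nonneg hC hln, mul_nonneg hC hlx]
  rw [hfac, abs_mul]
  calc _ ≤ |h n| * ((C + 1) * (x * (1 + Real.log x)) * ((n : ℝ)⁻¹ * (1 + Real.log n))) :=
        mul_le_mul_of_nonneg_left hbound (abs_nonneg _)
    _ = _ := by ring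

theorem stmt_6 :
    (fun N : ℝ =>
        (∑ n ∈ Finset.Icc 1 ⌊N⌋₊, if Odd n ∧ Squarefree n then (tauThree n : ℝ) else 0)
          - 1 / 5 * (∏' p : Nat.Primes, (1 - 1 / (p : ℝ)) ^ 3 * (1 + 3 / (p : ℝ)))
            * N * Real.log N ^ 2)
      =O[Filter.atTop] fun N : ℝ => N * Real.log N := by
  set M := ∑' n : ℕ, |tauThreeQuotient n| / n * (1 + Real.log n)
  have hM : 0 ≤ M := tsum_nonneg fun n =>
    mul_nonneg (by positivity) (by linarith [Real.log_natCast_nonneg n])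
  refine Asymptotics.IsBigO.of_bound ((5 + 1) * M * 2) ?_
  filter_upwards [Filter.eventually_ge_atTop (Real.exp 1)] with x hx
  have hx1 : 1 ≤ x := (Real.one_le_exp zero_le_one).trans hx
  have hlog : 1 ≤ Real.log x := (Real.le_log_iff_exp_le (by linarith)).2 hx
  have h := abs_sum_floor_mul_sub_le (by norm_num)
    (fun x => sum_floor_zeta_mul_zeta_mul_zeta (x := x)) summable_abs_tauThreeQuotient_mul_log
    summable_abs_tauThreeQuotient_div hx1
  rw [tauThreeQuotient_mul_zeta, tsum_tauThreeQuotient_div] at h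
  rw [Real.norm_eq_abs, Real.norm_eq_abs, abs_of_nonneg (by positivity : 0 ≤ x * Real.log x)]
  calc _ = _ := by
        congr 2
        ring
    _ ≤ _ := h
    _ ≤ (5 + 1) * M * (x * (2 * Real.log x)) := by gcongr; linarith
    _ = _ := by ring
end

section
/- Let (αₘ) and (βₙ) be complex numbers indexed by positive integers, supported on odd integers (αₘ = 0 for m even, βₙ = 0 for n even), with |αₘ| ≤ 1 and |βₙ| ≤ 1 for all m, n. Then for all X ≥ 2 and V ≥ 1, ∑∑_{m > V, n > V, mn ≤ X} αₘ·βₙ·J(m|n) ≪ X·V^{−1/6}·(log X)^{7/6}, with an absolute implied constant, where J(m|n) denotes the Jacobi symbol. -/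
open ZMod in
/-- A Gauss sum of a primitive Dirichlet character modulo `c` has norm `√c`. -/
theorem norm_gaussSum_of_isPrimitive {c : ℕ} [NeZero c] {χ : DirichletCharacter ℂ c}
    (hχ : χ.IsPrimitive) : ‖gaussSum χ stdAddChar‖ = √(c : ℝ) := by
  have h1 := congrFun (ZMod.dft_dft (χ : ZMod c → ℂ)) (-1)
  have h2 : (ZMod.dft (χ : ZMod c → ℂ)) = fun k => χ⁻¹ (-k) * gaussSum χ stdAddChar :=
    funext hχ.fourierTransform_eq_inv_mul_gaussSum
  rw [h2, ZMod.dft_apply] at h1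
  have h3 : ∑ j : ZMod c, stdAddChar (-(j * -1)) • (χ⁻¹ (-j) * gaussSum χ stdAddChar)
      = (starRingEnd ℂ) (gaussSum χ stdAddChar) * gaussSum χ stdAddChar := by
    rw [gaussSum, map_sum, Finset.sum_mul]
    refine Fintype.sum_equiv (Equiv.neg _) _ _ fun j => ?_
    have : (starRingEnd ℂ) (stdAddChar (-j)) = (stdAddChar j : ℂ) := by
      rw [stdAddChar_apply, stdAddChar_apply, ← Circle.coe_inv_eq_conj,
        AddChar.map_neg_eq_inv, inv_inv]
    simp only [Equiv.neg_apply, map_mul, smul_eq_mul, this, ← MulChar.star_apply', mul_neg_one,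
      neg_neg, starRingEnd_apply]
    ring
  rw [h3] at h1
  have h4 : ‖gaussSum χ stdAddChar‖ ^ 2 = (c : ℝ) := by
    have := congrArg norm h1
    simpa [sq] using this
  rw [← h4, Real.sqrt_sq (norm_nonneg _)]

theorem inv_sin_pi_mul_div_le {c x : ℕ} (hx : 0 < x) (hxc : x < c) :
    1 / |Real.sin (Real.pi * x / c)| ≤ c / 2 * (1 / x + 1 / (c - x : ℕ)) := by
  have hx' : (0 : ℝ) < x := by exact_mod_cast hx
  have hcx : (0 : ℝ) < (c - x : ℕ) := by exact_mod_cast Nat.sub_pos_of_lt hxc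
  have hc : (0 : ℝ) < c := by exact_mod_cast hx.trans hxc
  have key : ∀ y : ℝ, 0 < y → y ≤ c / 2 →
      1 / |Real.sin (Real.pi * y / c)| ≤ c / 2 * (1 / y) := by
    intro y hy hyc
    have h := Real.mul_le_sin (x := Real.pi * y / c) (by positivity) (by
      rw [div_le_div_iff₀ hc two_pos]
      nlinarith [Real.pi_pos])
    have h2 : 2 / Real.pi * (Real.pi * y / c) = 2 * y / c := by
      field_simp
    rw [h2] at h
    have h3 : 0 < 2 * y / c := by positivity
    calc 1 / |Real.sin (Real.pi * y / c)| ≤ 1 / (2 * y / c) :=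
          one_div_le_one_div_of_le h3 (h.trans (le_abs_self _))
      _ = c / 2 * (1 / y) := by field_simp
  rcases le_total (x : ℝ) (c / 2) with h | h
  · refine (key x hx' h).trans ?_
    gcongr
    have : (0 : ℝ) ≤ 1 / (c - x : ℕ) := by positivity
    linarith
  · have h1 := key (c - x : ℕ) hcx (by rw [Nat.cast_sub hxc.le]; linarith)
    have h2 : Real.sin (Real.pi * (c - x : ℕ) / c) = Real.sin (Real.pi * x / c) := by
      rw [← Real.sin_pi_sub]
      congr 1
      rw [Nat.cast_sub hxc.le]
      field_simp
      ring
    rw [h2] at h1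
    refine h1.trans ?_
    gcongr
    have : (0 : ℝ) ≤ 1 / (x : ℝ) := by positivity
    linarith

theorem sum_Icc_one_div_le (n : ℕ) :
    ∑ i ∈ Finset.Icc 1 n, (1 / (i : ℝ)) ≤ 1 + Real.log n := by
  have := harmonic_le_one_add_log n
  rw [harmonic_eq_sum_Icc] at this
  simpa using this

open ZMod in
theorem norm_sum_range_stdAddChar_le {c : ℕ} [NeZero c] {x : ℕ} (hx : 0 < x) (hxc : x < c)
    (Z : ℕ) :
    ‖∑ m ∈ Finset.range Z, (stdAddChar ((m : ZMod c) * (x : ZMod c)) : ℂ)‖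
      ≤ c / 2 * (1 / x + 1 / (c - x : ℕ)) := by
  have h1 : (stdAddChar (x : ZMod c) : ℂ)
      = Complex.exp (Complex.I * (2 * (Real.pi * x / c) : ℝ)) := by
    have := ZMod.stdAddChar_coe (N := c) (x : ℤ)
    rw [Int.cast_natCast] at this
    rw [this]
    congr 1
    push_cast
    ring
  set ζ : ℂ := stdAddChar (x : ZMod c) with hζ
  have hpow : ∀ m : ℕ, (stdAddChar ((m : ZMod c) * (x : ZMod c)) : ℂ) = ζ ^ m := by
    intro m
    rw [hζ, ← AddChar.map_nsmul_eq_pow, nsmul_eq_mul]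
  have hn : ‖ζ‖ = 1 := by
    rw [hζ, stdAddChar_apply]
    exact Circle.norm_coe _
  have h2 : ‖ζ - 1‖ = 2 * |Real.sin (Real.pi * x / c)| := by
    rw [h1, Complex.norm_exp_I_mul_ofReal_sub_one, Real.norm_eq_abs, abs_mul, abs_two]
    congr 3
    ring
  have hs : 0 < |Real.sin (Real.pi * x / c)| := by
    have hx' : (0 : ℝ) < x := by exact_mod_cast hx
    have hc : (0 : ℝ) < c := by exact_mod_cast hx.trans hxc
    have hxc' : (x : ℝ) < c := by exact_mod_cast hxc
    refine abs_pos.mpr (Real.sin_pos_of_pos_of_lt_pi (by positivity) ?_).ne'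
    rw [div_lt_iff₀ hc]
    exact mul_lt_mul_of_pos_left hxc' Real.pi_pos
  have h3 : ζ ≠ 1 := by
    intro h
    rw [h, sub_self, norm_zero] at h2
    linarith
  simp_rw [hpow]
  rw [geom_sum_eq h3, norm_div, h2]
  have h4 : ‖ζ ^ Z - 1‖ ≤ 2 := by
    refine (norm_sub_le _ _).trans ?_
    rw [norm_pow, hn]
    norm_num
  calc ‖ζ ^ Z - 1‖ / (2 * |Real.sin (Real.pi * x / c)|)
      ≤ 2 / (2 * |Real.sin (Real.pi * x / c)|) := by gcongr
    _ = 1 / |Real.sin (Real.pi * x / c)| := by field_simp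
    _ ≤ _ := inv_sin_pi_mul_div_le hx hxc

open ZMod in
/-- The Pólya–Vinogradov inequality for primitive Dirichlet characters. -/
theorem norm_sum_range_le_of_isPrimitive {c : ℕ} [NeZero c] {χ : DirichletCharacter ℂ c}
    (hχ : χ.IsPrimitive) (hc : c ≠ 1) (Z : ℕ) :
    ‖∑ m ∈ Finset.range Z, χ (m : ZMod c)‖ ≤ √(c : ℝ) * (1 + Real.log c) := by
  have hc1 : 1 < c := by
    have := NeZero.ne c
    omega
  have hc0 : (0 : ℝ) < c := by positivity
  have h0 : ‖∑ m ∈ Finset.range Z, χ (m : ZMod c)‖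
      = ‖∑ m ∈ Finset.range Z, χ⁻¹ (m : ZMod c)‖ := by
    rw [← norm_star, star_sum]
    simp_rw [MulChar.star_apply']
  have hG := norm_gaussSum_of_isPrimitive hχ
  have h1 : (∑ m ∈ Finset.range Z, χ⁻¹ (m : ZMod c)) * gaussSum χ stdAddChar
      = ∑ x ∈ Finset.range c, χ (x : ZMod c) *
        ∑ m ∈ Finset.range Z, stdAddChar ((m : ZMod c) * (x : ZMod c)) := by
    rw [Finset.sum_mul]
    simp_rw [← gaussSum_mulShift_of_isPrimitive (e := stdAddChar) hχ, gaussSum,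
      AddChar.mulShift_apply, Finset.mul_sum]
    rw [Finset.sum_comm' (t' := Finset.univ) (s' := fun _ => Finset.range Z)
      (by intros; simp)]
    symm
    refine Finset.sum_nbij (fun x : ℕ => (x : ZMod c)) (by simp) ?_ ?_ (by simp)
    · intro x hx y hy hxy
      simp only [Finset.coe_range, Set.mem_Iio] at hx hy
      have := congrArg ZMod.val hxy
      simpa [ZMod.val_natCast, Nat.mod_eq_of_lt hx, Nat.mod_eq_of_lt hy] using this
    · intro y _
      exact ⟨y.val, by simpa using ZMod.val_lt y, by simp⟩
  have h2 : ‖∑ x ∈ Finset.range c, χ (x : ZMod c) *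
        ∑ m ∈ Finset.range Z, (stdAddChar ((m : ZMod c) * (x : ZMod c)) : ℂ)‖
      ≤ ∑ x ∈ Finset.Ico 1 c, (c / 2 * (1 / (x : ℝ) + 1 / (c - x : ℕ))) := by
    rw [Finset.range_eq_Ico, Finset.sum_eq_sum_Ico_succ_bot (by omega)]
    have hz : χ ((0 : ℕ) : ZMod c) = 0 := by
      rw [Nat.cast_zero]
      exact DirichletCharacter.map_zero' χ hc
    rw [hz, zero_mul, zero_add, zero_add]
    refine (norm_sum_le _ _).trans (Finset.sum_le_sum fun x hx => ?_)
    rw [Finset.mem_Ico] at hx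
    rw [norm_mul]
    calc _ ≤ 1 * _ := mul_le_mul_of_nonneg_right (DirichletCharacter.norm_le_one _ _)
            (norm_nonneg _)
      _ ≤ _ := by
        rw [one_mul]
        exact norm_sum_range_stdAddChar_le hx.1 hx.2 Z
  have h3 : ∑ x ∈ Finset.Ico 1 c, (c / 2 * (1 / (x : ℝ) + 1 / (c - x : ℕ)))
      ≤ c * (1 + Real.log c) := by
    rw [← Finset.mul_sum, Finset.sum_add_distrib]
    have hr : ∑ x ∈ Finset.Ico 1 c, 1 / ((c - x : ℕ) : ℝ)
        = ∑ x ∈ Finset.Ico 1 c, 1 / (x : ℝ) := by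
      refine Finset.sum_nbij' (fun x => c - x) (fun x => c - x) ?_ ?_ ?_ ?_ ?_ <;>
        intro x hx <;> simp only [Finset.mem_Ico] at * <;> first | rfl | omega
    have hh : ∑ x ∈ Finset.Ico 1 c, 1 / (x : ℝ) ≤ 1 + Real.log c := by
      refine (Finset.sum_le_sum_of_subset_of_nonneg ?_ ?_).trans (sum_Icc_one_div_le c)
      · intro x hx
        simp only [Finset.mem_Ico, Finset.mem_Icc] at *
        omega
      · intros
        positivity
    rw [hr]
    nlinarith
  have h4 : ‖∑ m ∈ Finset.range Z, χ⁻¹ (m : ZMod c)‖ * √(c : ℝ) ≤ c * (1 + Real.log c) := by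
    rw [← hG, ← norm_mul, h1]
    exact h2.trans h3
  rw [h0]
  have hs : 0 < √(c : ℝ) := Real.sqrt_pos.mpr hc0
  refine le_of_mul_le_mul_right (h4.trans_eq ?_) hs
  nth_rewrite 1 [← Real.mul_self_sqrt hc0.le]
  ring

theorem sum_range_filter_dvd {e : ℕ} (he : 0 < e) (Z : ℕ) (f : ℕ → ℂ) :
    ∑ m ∈ Finset.range Z with e ∣ m, f m = ∑ k ∈ Finset.range ((Z + e - 1) / e), f (e * k) := by
  have key : ∀ k, k < (Z + e - 1) / e ↔ e * k < Z := by
    intro k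
    rw [Nat.lt_iff_add_one_le, Nat.le_div_iff_mul_le he, add_mul, one_mul, mul_comm k e]
    omega
  symm
  refine Finset.sum_nbij (fun k => e * k) ?_ ?_ ?_ (by simp)
  · intro k hk
    rw [Finset.mem_range, key] at hk
    simp [hk]
  · intro a _ b _ hab
    exact Nat.eq_of_mul_eq_mul_left he hab
  · intro m hm
    simp only [Finset.coe_filter, Finset.mem_range, Set.mem_ofPred_eq] at hm
    obtain ⟨hm, k, rfl⟩ := hm
    exact ⟨k, by simpa [key] using hm, rfl⟩

theorem sum_divisors_filter_dvd_moebius {d : ℕ} (hd : d ≠ 0) (m : ℕ) :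
    ∑ e ∈ d.divisors with e ∣ m, ArithmeticFunction.moebius e = if m.Coprime d then 1 else 0 := by
  have h : d.divisors.filter (· ∣ m) = (m.gcd d).divisors := by
    ext e
    have : m.gcd d ≠ 0 := fun h => hd (Nat.eq_zero_of_gcd_eq_zero_right h)
    simp only [Finset.mem_filter, Nat.mem_divisors, Nat.dvd_gcd_iff]
    tauto
  rw [h, ← ArithmeticFunction.coe_mul_zeta_apply, ArithmeticFunction.moebius_mul_coe_zeta,
    ArithmeticFunction.one_apply]

/-- A Pólya–Vinogradov inequality for arbitrary nontrivial Dirichlet characters. -/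
theorem norm_sum_range_le_of_ne_one {d : ℕ} [NeZero d] {χ : DirichletCharacter ℂ d}
    (hχ : χ ≠ 1) (Z : ℕ) :
    ‖∑ m ∈ Finset.range Z, χ (m : ZMod d)‖
      ≤ d.divisors.card * (√(d : ℝ) * (1 + Real.log d)) := by
  have hd : d ≠ 0 := NeZero.ne d
  have hc1 : χ.conductor ≠ 1 := fun h => hχ (DirichletCharacter.eq_one_iff_conductor_eq_one.mpr h)
  have hc0 : χ.conductor ≠ 0 := χ.conductor_ne_zero
  have : NeZero χ.conductor := ⟨hc0⟩
  set ψ := χ.primitiveCharacter with hψ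
  have h1 : ∀ m : ℕ, χ (m : ZMod d) = ∑ e ∈ d.divisors,
      (if e ∣ m then (ArithmeticFunction.moebius e : ℂ) * ψ (m : ZMod χ.conductor) else 0) := by
    intro m
    rw [← Finset.sum_filter, ← Finset.sum_mul, ← Int.cast_sum, sum_divisors_filter_dvd_moebius hd]
    split_ifs with h
    · have := χ.primitiveCharacter_apply_of_isCoprime (a := (m : ℤ)) (Nat.isCoprime_iff_coprime.mpr h)
      simpa using this.symm
    · rw [Int.cast_zero, zero_mul]
      exact MulChar.map_nonunit _ (by rwa [ZMod.isUnit_iff_coprime])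
  have hle : √(χ.conductor : ℝ) * (1 + Real.log χ.conductor) ≤ √(d : ℝ) * (1 + Real.log d) := by
    have hcd : (χ.conductor : ℝ) ≤ d := by
      exact_mod_cast Nat.le_of_dvd (Nat.pos_of_ne_zero hd) χ.conductor_dvd_level
    have hcp : (0 : ℝ) < χ.conductor := by exact_mod_cast Nat.pos_of_ne_zero hc0
    have hl : 0 ≤ Real.log χ.conductor := Real.log_natCast_nonneg _
    gcongr
  simp_rw [h1]
  rw [Finset.sum_comm, ← nsmul_eq_mul]
  refine (norm_sum_le _ _).trans (Finset.sum_le_card_nsmul _ _ _ fun e he => ?_)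
  rw [← Finset.sum_filter, ← Finset.mul_sum,
    sum_range_filter_dvd (Nat.pos_of_mem_divisors he) Z (fun m => ψ (m : ZMod χ.conductor))]
  simp_rw [Nat.cast_mul, map_mul, ← Finset.mul_sum]
  rw [norm_mul, norm_mul]
  have hm : ‖((ArithmeticFunction.moebius e : ℤ) : ℂ)‖ ≤ 1 := by
    rw [Complex.norm_intCast]
    exact_mod_cast ArithmeticFunction.abs_moebius_le_one
  have hPV := norm_sum_range_le_of_isPrimitive χ.primitiveCharacter_isPrimitive hc1
    ((Z + e - 1) / e)
  calc _ ≤ 1 * (1 * (√(χ.conductor : ℝ) * (1 + Real.log χ.conductor))) := by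
        gcongr
        exact DirichletCharacter.norm_le_one _ _
    _ ≤ _ := by rwa [one_mul, one_mul]

/-- The Jacobi symbol `x ↦ J(x | d)` as a Dirichlet character modulo `d`. -/
noncomputable def jacobiCharacter (d : ℕ) [NeZero d] : DirichletCharacter ℂ d where
  toFun x := (jacobiSym (x.val : ℤ) d : ℂ)
  map_one' := by
    have : jacobiSym ((1 : ZMod d).val : ℤ) d = 1 := by
      rw [ZMod.val_one_eq_one_mod, Int.natCast_mod, ← jacobiSym.mod_left, Nat.cast_one,
        jacobiSym.one_left]
    rw [this, Int.cast_one]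
  map_mul' x y := by
    rw [ZMod.val_mul, Int.natCast_mod, ← jacobiSym.mod_left, Nat.cast_mul, jacobiSym.mul_left,
      Int.cast_mul]
  map_nonunit' x hx := by
    have : jacobiSym (x.val : ℤ) d = 0 := by
      rw [jacobiSym.eq_zero_iff_not_coprime, Int.gcd_natCast_natCast]
      intro h
      apply hx
      rw [← ZMod.natCast_zmod_val x]
      exact (ZMod.isUnit_iff_coprime _ _).mpr h
    rw [this, Int.cast_zero]

theorem jacobiCharacter_natCast (d : ℕ) [NeZero d] (m : ℕ) :
    jacobiCharacter d (m : ZMod d) = (jacobiSym (m : ℤ) d : ℂ) := by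
  change (jacobiSym ((m : ZMod d).val : ℤ) d : ℂ) = _
  rw [ZMod.val_natCast, Int.natCast_mod, ← jacobiSym.mod_left]

theorem exists_jacobiSym_eq_neg_one {d : ℕ} (hodd : Odd d) (hd : ¬ IsSquare d) :
    ∃ x : ℕ, jacobiSym (x : ℤ) d = -1 := by
  have hd0 : d ≠ 0 := hodd.pos.ne'
  obtain ⟨s, u, hsu, hs⟩ := Nat.sq_mul_squarefree d
  have hs1 : s ≠ 1 := by
    rintro rfl
    exact hd ⟨u, by rw [← hsu]; ring⟩
  obtain ⟨p, hp, hps⟩ := Nat.exists_prime_and_dvd hs1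
  have : Fact p.Prime := ⟨hp⟩
  have hu0 : u ≠ 0 := by
    rintro rfl
    simp at hsu
    exact hd0 hsu.symm
  have hs0 : s ≠ 0 := hs.ne_zero
  have hpd : p ∣ d := hsu ▸ hps.mul_left _
  have hp2 : p ≠ 2 := by
    rintro rfl
    exact (Nat.not_even_iff_odd.mpr hodd) (even_iff_two_dvd.mpr hpd)
  obtain ⟨k, d', hpd', hkd⟩ := Nat.exists_eq_pow_mul_and_not_dvd hd0 p hp.ne_one
  have hd'0 : d' ≠ 0 := by
    rintro rfl
    exact hpd' (dvd_zero p)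
  have hk : Odd k := by
    have h1 : d.factorization p = k := by
      rw [hkd, Nat.factorization_mul (pow_ne_zero _ hp.ne_zero) hd'0, hp.factorization_pow]
      simp [Nat.factorization_eq_zero_of_not_dvd hpd']
    have h2 : s.factorization p = 1 := by
      have h3 := hs.natFactorization_le_one p
      have h4 := (hp.dvd_iff_one_le_factorization hs0).mp hps
      omega
    rw [← hsu, Nat.factorization_mul (pow_ne_zero _ hu0) hs0, Nat.factorization_pow] at h1
    simp [h2] at h1
    exact ⟨_, h1.symm⟩
  obtain ⟨a, ha⟩ := FiniteField.exists_nonsquare (F := ZMod p) (by rwa [ZMod.ringChar_zmod_n])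
  have hcop : p.Coprime d' := (Nat.Prime.coprime_iff_not_dvd hp).mpr hpd'
  obtain ⟨x, hx1, hx2⟩ := Nat.chineseRemainder hcop a.val 1
  refine ⟨x, ?_⟩
  have hJ1 : jacobiSym (x : ℤ) p = -1 := by
    rw [← jacobiSym.legendreSym.to_jacobiSym, legendreSym.eq_neg_one_iff]
    have : ((x : ℤ) : ZMod p) = a := by
      rw [Int.cast_natCast, (ZMod.natCast_eq_natCast_iff _ _ _).mpr hx1, ZMod.natCast_zmod_val]
    rwa [this]
  have hJ2 : jacobiSym (x : ℤ) d' = 1 := by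
    rw [← jacobiSym.one_left d']
    apply jacobiSym.mod_left'
    exact_mod_cast hx2
  rw [hkd, jacobiSym.mul_right' _ (pow_ne_zero _ hp.ne_zero) hd'0, jacobiSym.pow_right, hJ1, hJ2,
    hk.neg_one_pow, mul_one]

theorem abs_sum_jacobiSym_le {d : ℕ} (hodd : Odd d) (hd : ¬ IsSquare d) (Q : ℕ) :
    |∑ m ∈ Finset.Icc 1 Q, (jacobiSym (m : ℤ) d : ℝ)|
      ≤ d.divisors.card * (√(d : ℝ) * (1 + Real.log d)) := by
  have : NeZero d := ⟨hodd.pos.ne'⟩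
  obtain ⟨x, hx⟩ := exists_jacobiSym_eq_neg_one hodd hd
  have hd1 : 1 < d := by
    have h1 : d ≠ 1 := fun h => hd (h ▸ IsSquare.one)
    have := hodd.pos
    omega
  have hne : jacobiCharacter d ≠ 1 := by
    intro h
    have h1 := jacobiCharacter_natCast d x
    have hcop : IsUnit (x : ZMod d) := by
      rw [ZMod.isUnit_iff_coprime]
      by_contra hc
      rw [jacobiSym.eq_zero_iff_not_coprime.mpr (by simpa using hc)] at hx
      norm_num at hx
    rw [h, MulChar.one_apply hcop, hx] at h1
    norm_num at h1
  have := norm_sum_range_le_of_ne_one hne (Q + 1)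
  simp_rw [jacobiCharacter_natCast] at this
  rw [Finset.range_eq_Ico, Finset.sum_eq_sum_Ico_succ_bot (by omega), Nat.cast_zero,
    jacobiSym.zero_left hd1, Int.cast_zero, zero_add, zero_add,
    Finset.Ico_add_one_right_eq_Icc] at this
  rw [← Real.norm_eq_abs, ← Complex.norm_real]
  simpa using this

theorem sum_card_divisors_le (b : ℕ) :
    ∑ n ∈ Finset.Icc 1 b, (n.divisors.card : ℝ) ≤ b * (1 + Real.log b) := by
  have h1 : ∀ n ∈ Finset.Icc 1 b, (n.divisors.card : ℝ)
      = ∑ e ∈ Finset.Icc 1 b, if e ∣ n then (1 : ℝ) else 0 := by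
    intro n hn
    rw [Finset.mem_Icc] at hn
    rw [← Finset.sum_filter, Finset.sum_const, nsmul_one]
    congr 2
    ext e
    simp only [Nat.mem_divisors, Finset.mem_filter, Finset.mem_Icc]
    constructor
    · rintro ⟨h, _⟩
      exact ⟨⟨Nat.pos_of_dvd_of_pos h hn.1, (Nat.le_of_dvd hn.1 h).trans hn.2⟩, h⟩
    · rintro ⟨_, h⟩
      exact ⟨h, by omega⟩
  rw [Finset.sum_congr rfl h1, Finset.sum_comm]
  calc _ ≤ ∑ e ∈ Finset.Icc 1 b, (b : ℝ) * (1 / (e : ℝ)) := by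
        refine Finset.sum_le_sum fun e he => ?_
        rw [← Finset.sum_filter, Finset.sum_const, nsmul_one]
        have : (Finset.Icc 1 b).filter (e ∣ ·) = (Finset.Ioc 0 b).filter (e ∣ ·) := rfl
        rw [this, Nat.Ioc_filter_dvd_card_eq_div, mul_one_div]
        exact Nat.cast_div_le
    _ ≤ _ := by
        rw [← Finset.mul_sum]
        exact mul_le_mul_of_nonneg_left (sum_Icc_one_div_le b) (Nat.cast_nonneg _)

theorem card_divisors_mul_le (m n : ℕ) :
    (m * n).divisors.card ≤ m.divisors.card * n.divisors.card := by
  rw [Nat.divisors_mul]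
  exact Finset.card_mul_le

/-- There are at most `2 Y² (1 + log Y)` solutions of `m₁ m₂ = m₃ m₄` in `[1, Y]`. -/
theorem card_multiplicative_quadruples_le (Y : ℕ) :
    ((((Finset.Icc 1 Y ×ˢ Finset.Icc 1 Y) ×ˢ (Finset.Icc 1 Y ×ˢ Finset.Icc 1 Y)).filter
      (fun t : (ℕ × ℕ) × (ℕ × ℕ) => t.1.1 * t.1.2 = t.2.1 * t.2.2)).card : ℝ)
      ≤ 2 * (Y : ℝ) ^ 2 * (1 + Real.log Y) := by
  let S : Finset (Σ _ : ℕ × ℕ, ℕ × ℕ) := (Finset.Icc 1 Y ×ˢ Finset.Icc 1 Y).sigma fun p =>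
    Finset.Icc 1 (Y / max p.1 p.2) ×ˢ Finset.Icc 1 (Y / max p.1 p.2)
  let f : (Σ _ : ℕ × ℕ, ℕ × ℕ) → (ℕ × ℕ) × (ℕ × ℕ) := fun t =>
    ((t.2.1 * t.1.1, t.1.2 * t.2.2), (t.2.1 * t.1.2, t.1.1 * t.2.2))
  have hsub : ((Finset.Icc 1 Y ×ˢ Finset.Icc 1 Y) ×ˢ (Finset.Icc 1 Y ×ˢ Finset.Icc 1 Y)).filter
      (fun t : (ℕ × ℕ) × (ℕ × ℕ) => t.1.1 * t.1.2 = t.2.1 * t.2.2) ⊆ S.image f := by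
    rintro ⟨⟨m₁, m₂⟩, ⟨m₃, m₄⟩⟩ ht
    simp only [Finset.mem_filter, Finset.mem_product, Finset.mem_Icc] at ht
    obtain ⟨⟨⟨h1, h2⟩, h3, h4⟩, heq⟩ := ht
    obtain ⟨g, a, b, hg, hab, ha, hb⟩ := Nat.exists_coprime' (m := m₁) (n := m₃)
      (Nat.gcd_pos_of_pos_left _ h1.1)
    subst ha hb
    have hbm : b ∣ m₂ := by
      have : a * m₂ = b * m₄ := by
        apply Nat.eq_of_mul_eq_mul_left hg
        linarith [heq]
      exact hab.symm.dvd_of_dvd_mul_left ⟨m₄, this⟩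
    obtain ⟨h, rfl⟩ := hbm
    have hb0 : 0 < b := Nat.pos_of_mul_pos_right h3.1
    have ha0 : 0 < a := Nat.pos_of_mul_pos_right h1.1
    have hh0 : 0 < h := Nat.pos_of_mul_pos_left h2.1
    have hm4 : m₄ = a * h := by
      apply Nat.eq_of_mul_eq_mul_left (Nat.mul_pos hg hb0)
      linarith [heq]
    subst hm4
    refine Finset.mem_image.mpr ⟨⟨(a, b), (g, h)⟩, ?_, ?_⟩
    · have hmax : 0 < max a b := lt_max_of_lt_left ha0
      simp only [S, Finset.mem_sigma, Finset.mem_product, Finset.mem_Icc,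
        Nat.le_div_iff_mul_le hmax]
      refine ⟨⟨⟨ha0, ?_⟩, hb0, ?_⟩, ⟨hg, ?_⟩, hh0, ?_⟩
      · exact (Nat.le_mul_of_pos_right a hg).trans h1.2
      · exact (Nat.le_mul_of_pos_right b hg).trans h3.2
      · rcases max_choice a b with h | h <;> rw [h]
        · linarith
        · linarith
      · rcases max_choice a b with h | h <;> rw [h]
        · linarith
        · linarith
    · simp only [f]
      rw [mul_comm a g, mul_comm b g]
  have hcard : (S.card : ℝ) ≤ 2 * (Y : ℝ) ^ 2 * (1 + Real.log Y) := by
    have h1 : (S.card : ℝ) = ∑ p ∈ Finset.Icc 1 Y ×ˢ Finset.Icc 1 Y,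
        ((Y / max p.1 p.2 : ℕ) : ℝ) ^ 2 := by
      simp [S, Finset.card_sigma, sq]
    have h2 : ∀ p ∈ Finset.Icc 1 Y ×ˢ Finset.Icc 1 Y, ((Y / max p.1 p.2 : ℕ) : ℝ) ^ 2
        ≤ (if p.2 ≤ p.1 then ((Y : ℝ) / p.1) ^ 2 else 0)
          + (if p.1 ≤ p.2 then ((Y : ℝ) / p.2) ^ 2 else 0) := by
      intro p _
      rcases le_total p.1 p.2 with h | h
      · rw [max_eq_right h, if_pos h]
        have : ((Y / p.2 : ℕ) : ℝ) ^ 2 ≤ ((Y : ℝ) / p.2) ^ 2 := by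
          gcongr
          exact Nat.cast_div_le
        have h0 : (0 : ℝ) ≤ if p.2 ≤ p.1 then ((Y : ℝ) / p.1) ^ 2 else 0 := by
          split_ifs <;> positivity
        linarith
      · rw [max_eq_left h, if_pos h]
        have : ((Y / p.1 : ℕ) : ℝ) ^ 2 ≤ ((Y : ℝ) / p.1) ^ 2 := by
          gcongr
          exact Nat.cast_div_le
        have h0 : (0 : ℝ) ≤ if p.1 ≤ p.2 then ((Y : ℝ) / p.2) ^ 2 else 0 := by
          split_ifs <;> positivity
        linarith
    have h3 : ∑ a ∈ Finset.Icc 1 Y, ∑ b ∈ Finset.Icc 1 Y,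
        (if b ≤ a then ((Y : ℝ) / a) ^ 2 else 0) ≤ (Y : ℝ) ^ 2 * (1 + Real.log Y) := by
      calc _ = ∑ a ∈ Finset.Icc 1 Y, (Y : ℝ) ^ 2 * (1 / (a : ℝ)) := by
            refine Finset.sum_congr rfl fun a ha => ?_
            rw [Finset.mem_Icc] at ha
            have : (Finset.Icc 1 Y).filter (· ≤ a) = Finset.Icc 1 a := by
              ext b
              simp only [Finset.mem_filter, Finset.mem_Icc]
              omega
            rw [← Finset.sum_filter, this, Finset.sum_const, Nat.card_Icc, nsmul_eq_mul]
            have : (a : ℝ) ≠ 0 := by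
              have := ha.1
              positivity
            simp only [add_tsub_cancel_right]
            field_simp
        _ ≤ _ := by
            rw [← Finset.mul_sum]
            exact mul_le_mul_of_nonneg_left (sum_Icc_one_div_le Y) (by positivity)
    rw [h1]
    refine (Finset.sum_le_sum h2).trans ?_
    rw [Finset.sum_add_distrib, Finset.sum_product, Finset.sum_product_right]
    linarith
  refine le_trans ?_ hcard
  exact_mod_cast (Finset.card_le_card hsub).trans Finset.card_image_le

/-- There are at most `b (1 + log b)` pairs in `[1, b]` whose product is a square. -/
theorem card_pairs_isSquare_mul_le (b : ℕ) :
    (((Finset.Icc 1 b ×ˢ Finset.Icc 1 b).filter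
      (fun p : ℕ × ℕ => IsSquare (p.1 * p.2))).card : ℝ) ≤ b * (1 + Real.log b) := by
  let S : Finset (Σ _ : ℕ, ℕ × ℕ) := (Finset.Icc 1 b).sigma fun s =>
    Finset.Icc 1 (Nat.sqrt (b / s)) ×ˢ Finset.Icc 1 (Nat.sqrt (b / s))
  let f : (Σ _ : ℕ, ℕ × ℕ) → ℕ × ℕ := fun t => (t.2.1 ^ 2 * t.1, t.2.2 ^ 2 * t.1)
  have hsub : (Finset.Icc 1 b ×ˢ Finset.Icc 1 b).filter
      (fun p : ℕ × ℕ => IsSquare (p.1 * p.2)) ⊆ S.image f := by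
    rintro ⟨n₁, n₂⟩ hp
    simp only [Finset.mem_filter, Finset.mem_product, Finset.mem_Icc] at hp
    obtain ⟨⟨h1, h2⟩, z, hz⟩ := hp
    obtain ⟨s, u, rfl, hs⟩ := Nat.sq_mul_squarefree n₁
    obtain ⟨s', v, rfl, hs'⟩ := Nat.sq_mul_squarefree n₂
    have hu : 0 < u := Nat.pos_of_ne_zero fun h => by simp [h] at h1
    have hv : 0 < v := Nat.pos_of_ne_zero fun h => by simp [h] at h2
    have hs0 : 0 < s := Nat.pos_of_ne_zero hs.ne_zero
    have huvz : u * v ∣ z := by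
      rw [← Nat.pow_dvd_pow_iff two_ne_zero]
      exact ⟨s * s', by rw [sq z, ← hz]; ring⟩
    obtain ⟨w, rfl⟩ := huvz
    have hw : s * s' = w ^ 2 := by
      apply Nat.eq_of_mul_eq_mul_left (Nat.pow_pos (n := 2) (Nat.mul_pos hu hv))
      linarith [hz]
    have hsw : s ∣ w := (hs.dvd_pow_iff_dvd two_ne_zero).mp ⟨s', hw.symm⟩
    obtain ⟨t, rfl⟩ := hsw
    have hst : s' = s * (t * t) := by
      apply Nat.eq_of_mul_eq_mul_left hs0
      linarith [hw]
    have ht : t = 1 := Nat.isUnit_iff.mp (hs' t (hst ▸ dvd_mul_left _ _))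
    subst ht
    rw [mul_one, mul_one] at hst
    subst hst
    refine Finset.mem_image.mpr ⟨⟨s', (u, v)⟩, ?_, rfl⟩
    simp only [S, Finset.mem_sigma, Finset.mem_product, Finset.mem_Icc, Nat.le_sqrt',
      Nat.le_div_iff_mul_le hs0]
    exact ⟨⟨hs0, (Nat.le_mul_of_pos_left _ (by positivity)).trans h1.2⟩, ⟨hu, h1.2⟩, hv, h2.2⟩
  have hcard : (S.card : ℝ) ≤ b * (1 + Real.log b) := by
    have h1 : (S.card : ℝ) = ∑ s ∈ Finset.Icc 1 b, ((Nat.sqrt (b / s) : ℕ) : ℝ) ^ 2 := by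
      simp [S, Finset.card_sigma, sq]
    rw [h1]
    calc _ ≤ ∑ s ∈ Finset.Icc 1 b, (b : ℝ) * (1 / (s : ℝ)) := by
          refine Finset.sum_le_sum fun s _ => ?_
          rw [mul_one_div]
          refine le_trans ?_ (Nat.cast_div_le (m := b) (n := s) (α := ℝ))
          exact_mod_cast Nat.sqrt_le' _
      _ ≤ _ := by
          rw [← Finset.mul_sum]
          exact mul_le_mul_of_nonneg_left (sum_Icc_one_div_le b) (Nat.cast_nonneg _)
  refine le_trans ?_ hcard
  exact_mod_cast (Finset.card_le_card hsub).trans Finset.card_image_le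

/-- Second moment of complete sums over pairs of odd moduli. -/
theorem sum_sq_sum_jacobiSym_le {b : ℕ} (hb : 1 ≤ b) {B : Finset ℕ} (hB : B ⊆ Finset.Icc 1 b)
    (hodd : ∀ n ∈ B, Odd n) (Q : ℕ) :
    ∑ q ∈ Finset.Icc 1 Q, (∑ n ∈ B, (jacobiSym (q : ℤ) n : ℝ)) ^ 2
      ≤ Q * (b * (1 + Real.log b)) + 2 * (b : ℝ) ^ 3 * (1 + Real.log b) ^ 3 := by
  have hlb : 0 ≤ Real.log b := Real.log_natCast_nonneg _
  have h1 : ∑ q ∈ Finset.Icc 1 Q, (∑ n ∈ B, (jacobiSym (q : ℤ) n : ℝ)) ^ 2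
      = ∑ p ∈ B ×ˢ B, ∑ q ∈ Finset.Icc 1 Q, (jacobiSym (q : ℤ) (p.1 * p.2) : ℝ) := by
    rw [Finset.sum_comm]
    refine Finset.sum_congr rfl fun q _ => ?_
    rw [sq, Finset.sum_mul_sum, Finset.sum_product]
    refine Finset.sum_congr rfl fun n hn => Finset.sum_congr rfl fun n' hn' => ?_
    rw [jacobiSym.mul_right' _ (hodd n hn).pos.ne' (hodd n' hn').pos.ne', Int.cast_mul]
  have h2 : ∀ p ∈ B ×ˢ B, ∑ q ∈ Finset.Icc 1 Q, (jacobiSym (q : ℤ) (p.1 * p.2) : ℝ)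
      ≤ (if IsSquare (p.1 * p.2) then (Q : ℝ) else 0)
        + (p.1.divisors.card * p.2.divisors.card) * (b * (2 * (1 + Real.log b))) := by
    intro p hp
    rw [Finset.mem_product] at hp
    have ho := (hodd _ hp.1).mul (hodd _ hp.2)
    split_ifs with h
    · have : ∑ q ∈ Finset.Icc 1 Q, (jacobiSym (q : ℤ) (p.1 * p.2) : ℝ)
          ≤ ∑ q ∈ Finset.Icc 1 Q, (1 : ℝ) := by
        refine Finset.sum_le_sum fun q _ => ?_
        rcases jacobiSym.trichotomy (q : ℤ) (p.1 * p.2) with h | h | h <;> rw [h] <;> norm_num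
      simp only [Finset.sum_const, Nat.card_Icc, add_tsub_cancel_right, nsmul_eq_mul,
        mul_one] at this
      have h0 : 0 ≤ ((p.1.divisors.card : ℝ) * p.2.divisors.card) *
        (b * (2 * (1 + Real.log b))) := by positivity
      linarith
    · rw [zero_add]
      refine (le_abs_self _).trans ((abs_sum_jacobiSym_le ho h Q).trans ?_)
      have hb1 := Finset.mem_Icc.mp (hB hp.1)
      have hb2 := Finset.mem_Icc.mp (hB hp.2)
      have hle : ((p.1 * p.2 : ℕ) : ℝ) ≤ (b : ℝ) ^ 2 := by
        rw [sq]
        exact_mod_cast Nat.mul_le_mul hb1.2 hb2.2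
      have hpos : (0 : ℝ) < ((p.1 * p.2 : ℕ) : ℝ) := by exact_mod_cast ho.pos
      have hs : √((p.1 * p.2 : ℕ) : ℝ) ≤ b :=
        (Real.sqrt_le_sqrt hle).trans_eq (Real.sqrt_sq (Nat.cast_nonneg _))
      have hl : Real.log ((p.1 * p.2 : ℕ) : ℝ) ≤ 2 * Real.log b := by
        refine (Real.log_le_log hpos hle).trans_eq ?_
        rw [Real.log_pow, Nat.cast_two]
      have hd : ((p.1 * p.2).divisors.card : ℝ) ≤ p.1.divisors.card * p.2.divisors.card := by
        exact_mod_cast card_divisors_mul_le _ _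
      have hl0 : 0 ≤ Real.log ((p.1 * p.2 : ℕ) : ℝ) := Real.log_natCast_nonneg _
      gcongr
      linarith
  rw [h1]
  refine (Finset.sum_le_sum h2).trans ?_
  have h3 : ∑ p ∈ B ×ˢ B, (if IsSquare (p.1 * p.2) then (Q : ℝ) else 0)
      ≤ Q * (b * (1 + Real.log b)) := by
    rw [← Finset.sum_filter, Finset.sum_const, nsmul_eq_mul, mul_comm]
    refine mul_le_mul_of_nonneg_left ?_ (Nat.cast_nonneg _)
    refine le_trans ?_ (card_pairs_isSquare_mul_le b)
    exact_mod_cast Finset.card_le_card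
      (Finset.filter_subset_filter _ (Finset.product_subset_product hB hB))
  have h4 : ∑ n ∈ B, (n.divisors.card : ℝ) ≤ b * (1 + Real.log b) :=
    (Finset.sum_le_sum_of_subset_of_nonneg hB fun _ _ _ => Nat.cast_nonneg _).trans
      (sum_card_divisors_le b)
  have h5 : ∑ p ∈ B ×ˢ B, ((p.1.divisors.card : ℝ) * p.2.divisors.card)
      ≤ (b * (1 + Real.log b)) ^ 2 := by
    rw [Finset.sum_product]
    dsimp only
    rw [← Finset.sum_mul_sum, ← sq]
    gcongr
  rw [Finset.sum_add_distrib, ← Finset.sum_mul]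
  calc _ ≤ Q * (b * (1 + Real.log b))
        + (b * (1 + Real.log b)) ^ 2 * (b * (2 * (1 + Real.log b))) := by
        gcongr
    _ = _ := by ring

theorem sum_sq_card_fiber_le (Y : ℕ) :
    ∑ q ∈ Finset.Icc 1 (Y ^ 2), ((((Finset.Icc 1 Y ×ˢ Finset.Icc 1 Y).filter
      (fun p : ℕ × ℕ => p.1 * p.2 = q)).card : ℝ)) ^ 2 ≤ 2 * (Y : ℝ) ^ 2 * (1 + Real.log Y) := by
  refine le_trans (le_of_eq ?_) (card_multiplicative_quadruples_le Y)
  rw [Finset.card_eq_sum_card_fiberwise (f := fun t : (ℕ × ℕ) × (ℕ × ℕ) => t.1.1 * t.1.2)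
    (t := Finset.Icc 1 (Y ^ 2))]
  · push_cast
    refine Finset.sum_congr rfl fun q _ => ?_
    rw [sq, ← Nat.cast_mul, ← Finset.card_product]
    congr 2
    ext t
    simp only [Finset.mem_filter, Finset.mem_product]
    constructor
    · rintro ⟨⟨h1, h2⟩, h3, h4⟩
      exact ⟨⟨⟨h1, h3⟩, h2.trans h4.symm⟩, h2⟩
    · rintro ⟨⟨⟨h1, h3⟩, h2⟩, h4⟩
      exact ⟨⟨h1, h4⟩, h3, h2.symm.trans h4⟩
  · intro t ht
    simp only [Finset.coe_filter, Finset.mem_product, Finset.mem_Icc, Set.mem_ofPred_eq] at ht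
    simp only [Finset.coe_Icc, Set.mem_Icc]
    obtain ⟨⟨⟨⟨h1, h2⟩, h3, h4⟩, -⟩, -⟩ := ht
    exact ⟨Nat.mul_pos h1 h3, by rw [sq]; exact Nat.mul_le_mul h2 h4⟩

/-- A fourth power bound for bilinear forms in Jacobi symbols. -/
theorem norm_bilinear_pow_four_le {b : ℕ} (hb : 1 ≤ b) {B : Finset ℕ} (hB : B ⊆ Finset.Icc 1 b)
    (hodd : ∀ n ∈ B, Odd n) (Y : ℕ) {α β : ℕ → ℂ} (hα : ∀ m, ‖α m‖ ≤ 1) (hβ : ∀ n, ‖β n‖ ≤ 1) :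
    ‖∑ n ∈ B, β n * ∑ m ∈ Finset.Icc 1 Y, α m * (jacobiSym (m : ℤ) n : ℂ)‖ ^ 4
      ≤ (B.card : ℝ) ^ 2 * (2 * (Y : ℝ) ^ 2 * (1 + Real.log Y)) *
        ((Y : ℝ) ^ 2 * (b * (1 + Real.log b)) + 2 * (b : ℝ) ^ 3 * (1 + Real.log b) ^ 3) := by
  set T : ℕ → ℂ := fun n => ∑ m ∈ Finset.Icc 1 Y, α m * (jacobiSym (m : ℤ) n : ℂ) with hT
  set F : ℕ → ℝ := fun q => ∑ n ∈ B, (jacobiSym (q : ℤ) n : ℝ) with hF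
  set r : ℕ → ℝ := fun q => (((Finset.Icc 1 Y ×ˢ Finset.Icc 1 Y).filter
      (fun p : ℕ × ℕ => p.1 * p.2 = q)).card : ℝ) with hr
  set W : ℝ := ∑ n ∈ B, ‖T n‖ ^ 2 with hW
  have hS : ‖∑ n ∈ B, β n * T n‖ ^ 2 ≤ B.card * W := by
    refine le_trans ?_ sq_sum_le_card_mul_sum_sq
    gcongr
    refine (norm_sum_le _ _).trans (Finset.sum_le_sum fun n _ => ?_)
    rw [norm_mul]
    exact mul_le_of_le_one_left (norm_nonneg _) (hβ n)
  have hW1 : (W : ℂ) = ∑ p ∈ Finset.Icc 1 Y ×ˢ Finset.Icc 1 Y,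
      α p.1 * (starRingEnd ℂ) (α p.2) * (F (p.1 * p.2) : ℂ) := by
    have h1 : ∀ n, ((‖T n‖ ^ 2 : ℝ) : ℂ) = ∑ p ∈ Finset.Icc 1 Y ×ˢ Finset.Icc 1 Y,
        α p.1 * (starRingEnd ℂ) (α p.2) * ((jacobiSym ((p.1 * p.2 : ℕ) : ℤ) n : ℝ) : ℂ) := by
      intro n
      rw [Complex.ofReal_pow, ← Complex.mul_conj', hT, map_sum, Finset.sum_mul_sum,
        Finset.sum_product]
      refine Finset.sum_congr rfl fun i _ => Finset.sum_congr rfl fun j _ => ?_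
      rw [Nat.cast_mul, jacobiSym.mul_left, map_mul, map_intCast (starRingEnd ℂ)]
      push_cast
      ring
    rw [hW, Complex.ofReal_sum, Finset.sum_congr rfl fun n _ => h1 n, Finset.sum_comm]
    refine Finset.sum_congr rfl fun p _ => ?_
    rw [← Finset.mul_sum, hF, Complex.ofReal_sum]
  have hW0 : 0 ≤ W := Finset.sum_nonneg fun _ _ => sq_nonneg _
  have hW2 : W ≤ ∑ q ∈ Finset.Icc 1 (Y ^ 2), r q * |F q| := by
    have h1 : W ≤ ∑ p ∈ Finset.Icc 1 Y ×ˢ Finset.Icc 1 Y, |F (p.1 * p.2)| := by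
      have : W = ‖(W : ℂ)‖ := by rw [Complex.norm_real, Real.norm_of_nonneg hW0]
      rw [this, hW1]
      refine (norm_sum_le _ _).trans (Finset.sum_le_sum fun p _ => ?_)
      rw [norm_mul, norm_mul, RCLike.norm_conj, Complex.norm_real, Real.norm_eq_abs]
      exact mul_le_of_le_one_left (abs_nonneg _)
        (mul_le_one₀ (hα _) (norm_nonneg _) (hα _))
    refine h1.trans_eq ?_
    rw [← Finset.sum_fiberwise_of_maps_to (g := fun p : ℕ × ℕ => p.1 * p.2)
      (t := Finset.Icc 1 (Y ^ 2))]
    · refine Finset.sum_congr rfl fun q _ => ?_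
      rw [hr, ← nsmul_eq_mul, ← Finset.sum_const]
      refine Finset.sum_congr rfl fun p hp => ?_
      rw [(Finset.mem_filter.mp hp).2]
    · intro p hp
      simp only [Finset.mem_product, Finset.mem_Icc] at hp ⊢
      exact ⟨Nat.mul_pos hp.1.1 hp.2.1, by rw [sq]; exact Nat.mul_le_mul hp.1.2 hp.2.2⟩
  have hW3 : W ^ 2 ≤ (2 * (Y : ℝ) ^ 2 * (1 + Real.log Y)) *
      ((Y : ℝ) ^ 2 * (b * (1 + Real.log b)) + 2 * (b : ℝ) ^ 3 * (1 + Real.log b) ^ 3) := by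
    have hly : 0 ≤ Real.log Y := Real.log_natCast_nonneg _
    calc W ^ 2 ≤ (∑ q ∈ Finset.Icc 1 (Y ^ 2), r q * |F q|) ^ 2 := by gcongr
      _ ≤ (∑ q ∈ Finset.Icc 1 (Y ^ 2), r q ^ 2) * ∑ q ∈ Finset.Icc 1 (Y ^ 2), |F q| ^ 2 :=
        Finset.sum_mul_sq_le_sq_mul_sq _ _ _
      _ ≤ _ := by
        refine mul_le_mul (sum_sq_card_fiber_le Y) ?_ (Finset.sum_nonneg fun _ _ => sq_nonneg _)
          (by positivity)
        simp_rw [sq_abs]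
        rw [← Nat.cast_pow Y 2]
        exact sum_sq_sum_jacobiSym_le hb hB hodd (Y ^ 2)
  calc ‖∑ n ∈ B, β n * T n‖ ^ 4 = (‖∑ n ∈ B, β n * T n‖ ^ 2) ^ 2 := by ring
    _ ≤ (B.card * W) ^ 2 := by gcongr
    _ = (B.card : ℝ) ^ 2 * W ^ 2 := by ring
    _ ≤ _ := by
      rw [mul_assoc]
      gcongr

/-- The contribution of a block of moduli between consecutive sixth powers. -/
theorem norm_sum_sixth_power_block_le {X : ℝ} (hX : 2 ≤ X) {k : ℕ} (hk : 1 ≤ k) {B : Finset ℕ}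
    (hodd : ∀ n ∈ B, Odd n) (hlow : ∀ n ∈ B, k ^ 6 < n) (hup : ∀ n ∈ B, n ≤ (k + 1) ^ 6)
    (hBX : ∀ n ∈ B, (n : ℝ) ^ 2 ≤ X) {α β : ℕ → ℂ} (hα : ∀ m, ‖α m‖ ≤ 1) (hβ : ∀ n, ‖β n‖ ≤ 1) :
    ‖∑ n ∈ B, β n * ∑ m ∈ Finset.Icc 1 ⌊X / n⌋₊, α m * (jacobiSym (m : ℤ) n : ℂ)‖
      ≤ 60000 * X * Real.log X * (((k + 1 : ℕ) : ℝ) ^ 2)⁻¹ := by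
  have hX0 : 0 < X := by linarith
  have hL : 1 / 2 ≤ Real.log X := by
    have h1 := Real.log_le_log two_pos hX
    linarith [Real.log_two_gt_d9]
  rcases B.eq_empty_or_nonempty with rfl | ⟨n₀, hn₀⟩
  · simp only [Finset.sum_empty, norm_zero]
    positivity
  set i : ℝ := ((k + 1 : ℕ) : ℝ) with hi
  have hk1 : (1 : ℝ) ≤ k := by exact_mod_cast hk
  have hik : i = k + 1 := by rw [hi]; push_cast; ring
  have hi0 : 0 < i := by rw [hik]; positivity
  have hi1 : 1 ≤ i := by rw [hik]; linarith
  have hi2k : i ≤ 2 * k := by rw [hik]; linarith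
  have hk0 : (0 : ℝ) < k := by linarith
  have hi64 : i ^ 6 ≤ 64 * (k : ℝ) ^ 6 := by
    calc i ^ 6 ≤ (2 * (k : ℝ)) ^ 6 := by gcongr
      _ = _ := by ring
  have hi12 : i ^ 12 ≤ 4096 * X := by
    have h1 : (k : ℝ) ^ 6 ≤ n₀ := by exact_mod_cast (hlow n₀ hn₀).le
    calc i ^ 12 = (i ^ 6) ^ 2 := by ring
      _ ≤ (64 * (n₀ : ℝ)) ^ 2 := by
        gcongr
        linarith
      _ = 4096 * (n₀ : ℝ) ^ 2 := by ring
      _ ≤ _ := by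
        have := hBX n₀ hn₀
        linarith
  set b : ℕ := (k + 1) ^ 6 with hb
  have hbi : (b : ℝ) = i ^ 6 := by rw [hb, hi, Nat.cast_pow]
  have hb1 : 1 ≤ b := Nat.one_le_pow _ _ (by omega)
  have hdiff : i ^ 6 - (k : ℝ) ^ 6 ≤ 6 * i ^ 5 := by
    rw [hik]
    have : 0 ≤ 15 * (k : ℝ) ^ 4 + 40 * k ^ 3 + 45 * k ^ 2 + 24 * k + 5 := by positivity
    nlinarith
  have hcard : (B.card : ℝ) ≤ 6 * i ^ 5 := by
    have h1 : B.card ≤ (k + 1) ^ 6 - k ^ 6 := by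
      rw [← Nat.card_Ioc]
      exact Finset.card_le_card fun n hn => Finset.mem_Ioc.mpr ⟨hlow n hn, hup n hn⟩
    refine le_trans (Nat.cast_le.mpr h1) ?_
    rw [Nat.cast_sub (Nat.pow_le_pow_left (by omega) 6), Nat.cast_pow, Nat.cast_pow, ← hi]
    exact hdiff
  set Y : ℕ := ⌊X / b⌋₊ with hY
  have hYle : (Y : ℝ) ≤ X / i ^ 6 := by
    rw [hY, hbi]
    exact Nat.floor_le (by positivity)
  have hYgt : X / i ^ 6 < Y + 1 := by
    rw [hY, hbi]
    exact Nat.lt_floor_add_one _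
  set l : ℝ := 9 * Real.log X with hl
  have hl1 : 1 ≤ l := by linarith
  have hlogY : 1 + Real.log Y ≤ l := by
    rcases Nat.eq_zero_or_pos Y with h | h
    · simpa [h] using hl1
    · have h1 : (Y : ℝ) ≤ X := hYle.trans (div_le_self hX0.le (one_le_pow₀ hi1))
      have := Real.log_le_log (by exact_mod_cast h) h1
      linarith
  have hlogb : 1 + Real.log b ≤ l := by
    have h1 : Real.log ((b : ℝ) ^ 2) ≤ Real.log (4096 * X) := by
      refine Real.log_le_log (by positivity) ?_
      rw [hbi]
      calc (i ^ 6) ^ 2 = i ^ 12 := by ring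
        _ ≤ _ := hi12
    have h2 : Real.log 4096 = 12 * Real.log 2 := by
      rw [show (4096 : ℝ) = 2 ^ 12 by norm_num, Real.log_pow]
      norm_num
    rw [Real.log_pow, Real.log_mul (by norm_num) hX0.ne', h2, Nat.cast_two] at h1
    have h3 := Real.log_le_log two_pos hX
    linarith
  have hmain : ‖∑ n ∈ B, β n * ∑ m ∈ Finset.Icc 1 Y, α m * (jacobiSym (m : ℤ) n : ℂ)‖
      ≤ 512 * (X * l / i ^ 2) := by
    have hB : B ⊆ Finset.Icc 1 b := fun n hn =>
      Finset.mem_Icc.mpr ⟨(hodd n hn).pos, hup n hn⟩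
    have h1 := norm_bilinear_pow_four_le hb1 hB hodd Y hα hβ
    have hlY0 : 0 ≤ Real.log Y := Real.log_natCast_nonneg _
    have hlb0 : 0 ≤ Real.log b := Real.log_natCast_nonneg _
    have h2 : (Y : ℝ) ^ 2 * (b * (1 + Real.log b)) + 2 * (b : ℝ) ^ 3 * (1 + Real.log b) ^ 3
        ≤ 2 ^ 26 * X ^ 2 * l ^ 3 / i ^ 6 := by
      have hll : l ≤ l ^ 3 := by nlinarith [sq_nonneg l]
      have e1 : (Y : ℝ) ^ 2 * (b * (1 + Real.log b)) ≤ X ^ 2 * l ^ 3 / i ^ 6 := by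
        calc _ ≤ (X / i ^ 6) ^ 2 * (i ^ 6 * l ^ 3) := by
              rw [← hbi]
              rw [← hbi] at hYle
              gcongr
              exact hlogb.trans hll
          _ = _ := by field_simp
      have e2 : 2 * (b : ℝ) ^ 3 * (1 + Real.log b) ^ 3 ≤ 2 * (4096 * X) ^ 2 * l ^ 3 / i ^ 6 := by
        calc _ ≤ 2 * (i ^ 6) ^ 3 * l ^ 3 := by
              rw [← hbi]
              gcongr
          _ = 2 * (i ^ 12) ^ 2 * l ^ 3 / i ^ 6 := by field_simp
          _ ≤ _ := by gcongr
      have e3 : 0 ≤ X ^ 2 * l ^ 3 / i ^ 6 := by positivity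
      calc _ ≤ X ^ 2 * l ^ 3 / i ^ 6 + 2 * (4096 * X) ^ 2 * l ^ 3 / i ^ 6 := add_le_add e1 e2
        _ = (1 + 2 * 4096 ^ 2) * (X ^ 2 * l ^ 3 / i ^ 6) := by ring
        _ ≤ 2 ^ 26 * (X ^ 2 * l ^ 3 / i ^ 6) := by
          gcongr
          norm_num
        _ = _ := by ring
    refine le_of_pow_le_pow_left₀ (n := 4) (by norm_num) (by positivity) (h1.trans ?_)
    calc _ ≤ (6 * i ^ 5) ^ 2 * (2 * (X / i ^ 6) ^ 2 * l) * (2 ^ 26 * X ^ 2 * l ^ 3 / i ^ 6) := by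
          gcongr
      _ = (72 * 2 ^ 26) * (X * l / i ^ 2) ^ 4 := by
          field_simp
          norm_num
      _ ≤ 512 ^ 4 * (X * l / i ^ 2) ^ 4 := by
          gcongr
          norm_num
      _ = _ := by ring
  have herr : ‖∑ n ∈ B, β n * ∑ m ∈ Finset.Icc 1 ⌊X / n⌋₊, α m * (jacobiSym (m : ℤ) n : ℂ)
      - ∑ n ∈ B, β n * ∑ m ∈ Finset.Icc 1 Y, α m * (jacobiSym (m : ℤ) n : ℂ)‖
      ≤ 26880 * (X / i ^ 2) := by
    have hterm : ∀ n ∈ B, ‖β n * ∑ m ∈ Finset.Icc 1 ⌊X / n⌋₊, α m * (jacobiSym (m : ℤ) n : ℂ)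
        - β n * ∑ m ∈ Finset.Icc 1 Y, α m * (jacobiSym (m : ℤ) n : ℂ)‖
        ≤ 384 * X / i ^ 7 + 1 := by
      intro n hn
      have hn0 : (0 : ℝ) < n := by exact_mod_cast (hodd n hn).pos
      have hYn : Y ≤ ⌊X / n⌋₊ := by
        rw [hY]
        gcongr
        exact_mod_cast hup n hn
      have hsub : Finset.Icc 1 Y ⊆ Finset.Icc 1 ⌊X / n⌋₊ := Finset.Icc_subset_Icc_right hYn
      rw [← mul_sub, ← Finset.sum_sdiff hsub, add_sub_cancel_right, norm_mul]
      have h1 : ‖∑ m ∈ Finset.Icc 1 ⌊X / n⌋₊ \ Finset.Icc 1 Y, α m * (jacobiSym (m : ℤ) n : ℂ)‖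
          ≤ (⌊X / n⌋₊ : ℝ) - Y := by
        refine (norm_sum_le_of_le (n := fun _ => (1 : ℝ)) _ fun m _ => ?_).trans_eq ?_
        · rw [norm_mul]
          refine mul_le_one₀ (hα m) (norm_nonneg _) ?_
          rcases jacobiSym.trichotomy (m : ℤ) n with h | h | h <;> rw [h] <;> norm_num
        · rw [Finset.sum_const, nsmul_one, Finset.card_sdiff_of_subset hsub, Nat.card_Icc,
            Nat.card_Icc, Nat.add_sub_cancel, Nat.add_sub_cancel, Nat.cast_sub hYn]
      have h2 : (⌊X / n⌋₊ : ℝ) ≤ X / n := Nat.floor_le (by positivity)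
      have h3 : X / n ≤ X / (k : ℝ) ^ 6 := by
        gcongr
        exact_mod_cast (hlow n hn).le
      have h4 : X / (k : ℝ) ^ 6 - X / i ^ 6 ≤ 384 * X / i ^ 7 := by
        calc X / (k : ℝ) ^ 6 - X / i ^ 6 = X * (i ^ 6 - (k : ℝ) ^ 6) / (k ^ 6 * i ^ 6) := by
              field_simp
          _ ≤ X * (6 * i ^ 5) / (i ^ 6 / 64 * i ^ 6) := by
              gcongr
              linarith
          _ = _ := by
              field_simp
              norm_num
      calc _ ≤ 1 * ((⌊X / n⌋₊ : ℝ) - Y) := by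
            gcongr
            exact hβ n
        _ ≤ _ := by linarith
    rw [← Finset.sum_sub_distrib]
    calc _ ≤ ∑ n ∈ B, (384 * X / i ^ 7 + 1) := norm_sum_le_of_le _ hterm
      _ = B.card * (384 * X / i ^ 7 + 1) := by rw [Finset.sum_const, nsmul_eq_mul]
      _ ≤ 6 * i ^ 5 * (384 * X / i ^ 7 + 1) := by gcongr
      _ = 2304 * (X / i ^ 2) + 6 * (i ^ 7 / i ^ 2) := by
          field_simp
          ring
      _ ≤ 2304 * (X / i ^ 2) + 6 * (4096 * X / i ^ 2) := by
          gcongr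
          exact (pow_le_pow_right₀ hi1 (by norm_num)).trans hi12
      _ = _ := by ring
  have htri := norm_add_le
    (∑ n ∈ B, β n * ∑ m ∈ Finset.Icc 1 ⌊X / n⌋₊, α m * (jacobiSym (m : ℤ) n : ℂ)
      - ∑ n ∈ B, β n * ∑ m ∈ Finset.Icc 1 Y, α m * (jacobiSym (m : ℤ) n : ℂ))
    (∑ n ∈ B, β n * ∑ m ∈ Finset.Icc 1 Y, α m * (jacobiSym (m : ℤ) n : ℂ))
  rw [sub_add_cancel] at htri
  have hXi : 0 ≤ X / i ^ 2 := by positivity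
  calc _ ≤ 26880 * (X / i ^ 2) + 512 * (X * l / i ^ 2) := htri.trans (add_le_add herr hmain)
    _ = (26880 + 4608 * Real.log X) * (X / i ^ 2) := by
        rw [hl]
        ring
    _ ≤ (60000 * Real.log X) * (X / i ^ 2) := by
        gcongr
        linarith
    _ = _ := by ring

/-- The bilinear sum under the hyperbola `m n ≤ X`, when `n` runs over the short variable. -/
theorem norm_sum_hyperbola_short_le {X V : ℝ} (hX : 2 ≤ X) (hV : 1 ≤ V) {α β : ℕ → ℂ}
    (hα : ∀ m, ‖α m‖ ≤ 1) (hβ : ∀ n, ‖β n‖ ≤ 1)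
    (hsupp : ∀ n, β n ≠ 0 → Odd n ∧ V < n ∧ (n : ℝ) ^ 2 ≤ X) :
    ‖∑ n ∈ Finset.Icc 1 ⌊X⌋₊, ∑ m ∈ Finset.Icc 1 ⌊X⌋₊,
      if ((m * n : ℕ) : ℝ) ≤ X then α m * β n * (jacobiSym (m : ℤ) n : ℂ) else 0‖
      ≤ 120000 * X * Real.log X * V ^ (-(1 : ℝ) / 6) := by
  have hX0 : 0 < X := by linarith
  have hV0 : 0 < V := by linarith
  classical
  set N := (Finset.Icc 1 ⌊X⌋₊).filter (fun n : ℕ => Odd n ∧ V < (n : ℝ) ∧ (n : ℝ) ^ 2 ≤ X) with hN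
  have h1 : ∑ n ∈ Finset.Icc 1 ⌊X⌋₊, ∑ m ∈ Finset.Icc 1 ⌊X⌋₊,
      (if ((m * n : ℕ) : ℝ) ≤ X then α m * β n * (jacobiSym (m : ℤ) n : ℂ) else 0)
      = ∑ n ∈ N, β n * ∑ m ∈ Finset.Icc 1 ⌊X / n⌋₊, α m * (jacobiSym (m : ℤ) n : ℂ) := by
    have hsub : N ⊆ Finset.Icc 1 ⌊X⌋₊ := Finset.filter_subset _ _
    rw [← Finset.sum_subset hsub]
    · refine Finset.sum_congr rfl fun n hn => ?_
      have hn1 : 1 ≤ n := (Finset.mem_Icc.mp (Finset.mem_filter.mp hn).1).1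
      have hn0 : (0 : ℝ) < n := by exact_mod_cast hn1
      rw [← Finset.sum_filter, Finset.mul_sum]
      refine Finset.sum_congr ?_ fun m _ => by ring
      ext m
      simp only [Finset.mem_filter, Finset.mem_Icc, Nat.le_floor_iff hX0.le,
        Nat.le_floor_iff (div_nonneg hX0.le hn0.le), le_div_iff₀ hn0, Nat.cast_mul]
      constructor
      · rintro ⟨⟨h1, _⟩, h3⟩
        exact ⟨h1, h3⟩
      · rintro ⟨h1, h3⟩
        refine ⟨⟨h1, le_trans ?_ h3⟩, h3⟩
        exact le_mul_of_one_le_right (Nat.cast_nonneg _) (by exact_mod_cast hn1)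
    · intro n hn hnN
      have : β n = 0 := by
        by_contra h
        exact hnN (Finset.mem_filter.mpr ⟨hn, hsupp n h⟩)
      simp [this]
  have hex : ∀ n : ℕ, ∃ i, n ≤ i ^ 6 := fun n => ⟨n, Nat.le_self_pow (by norm_num) n⟩
  set g : ℕ → ℕ := fun n => Nat.find (hex n) with hg
  set v : ℕ := ⌊V ^ ((1 : ℝ) / 6)⌋₊ with hv
  have hV6 : (V ^ ((1 : ℝ) / 6)) ^ 6 = V := by
    rw [← Real.rpow_natCast, ← Real.rpow_mul hV0.le]
    norm_num
  have hmaps : ∀ n ∈ N, g n ∈ Finset.Ioo v (⌊X⌋₊ + 1) := by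
    intro n hn
    obtain ⟨hn1, -, hVn, -⟩ := Finset.mem_filter.mp hn
    rw [Finset.mem_Ioo]
    constructor
    · have h2 : (n : ℝ) ≤ (g n : ℝ) ^ 6 := by exact_mod_cast Nat.find_spec (hex n)
      have h3 : V ^ ((1 : ℝ) / 6) < g n := by
        refine lt_of_pow_lt_pow_left₀ 6 (Nat.cast_nonneg _) ?_
        rw [hV6]
        linarith
      exact (Nat.floor_lt (by positivity)).mpr h3
    · have : g n ≤ n := Nat.find_min' (hex n) (Nat.le_self_pow (by norm_num) n)
      have := (Finset.mem_Icc.mp hn1).2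
      omega
  have hblock : ∀ i ∈ Finset.Ioo v (⌊X⌋₊ + 1), ‖∑ n ∈ N with g n = i, β n *
      ∑ m ∈ Finset.Icc 1 ⌊X / n⌋₊, α m * (jacobiSym (m : ℤ) n : ℂ)‖
      ≤ 60000 * X * Real.log X * ((i : ℝ) ^ 2)⁻¹ := by
    intro i _
    have hlog : 0 ≤ Real.log X := Real.log_nonneg (by linarith)
    rcases (N.filter (g · = i)).eq_empty_or_nonempty with h | ⟨n₀, hn₀⟩
    · rw [h, Finset.sum_empty, norm_zero]
      positivity
    have hi2 : 2 ≤ i := by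
      obtain ⟨hn, rfl⟩ := Finset.mem_filter.mp hn₀
      obtain ⟨-, -, hVn, -⟩ := Finset.mem_filter.mp hn
      have h2 : 1 < n₀ := by exact_mod_cast hV.trans_lt hVn
      by_contra hlt
      have h3 := Nat.find_spec (hex n₀)
      have h4 : g n₀ ^ 6 ≤ 1 ^ 6 := Nat.pow_le_pow_left (by omega) 6
      simp only [hg] at h4
      omega
    obtain ⟨k, rfl⟩ : ∃ k, i = k + 1 := ⟨i - 1, by omega⟩
    refine norm_sum_sixth_power_block_le hX (by omega) ?_ ?_ ?_ ?_ hα hβ <;> intro n hn <;>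
      obtain ⟨hn, hgn⟩ := Finset.mem_filter.mp hn <;>
      obtain ⟨-, hno, -, hnX⟩ := Finset.mem_filter.mp hn
    · exact hno
    · have : ¬ n ≤ k ^ 6 := Nat.find_min (hex n) (m := k) (by
        change k < g n
        omega)
      omega
    · rw [← hgn]
      exact Nat.find_spec (hex n)
    · exact hnX
  rw [h1, ← Finset.sum_fiberwise_of_maps_to hmaps]
  have hlog : 0 ≤ Real.log X := Real.log_nonneg (by linarith)
  have hVr : V ^ (-(1 : ℝ) / 6) = (V ^ ((1 : ℝ) / 6))⁻¹ := by
    rw [neg_div, Real.rpow_neg hV0.le]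
  calc _ ≤ ∑ i ∈ Finset.Ioo v (⌊X⌋₊ + 1), 60000 * X * Real.log X * ((i : ℝ) ^ 2)⁻¹ :=
        norm_sum_le_of_le _ hblock
    _ ≤ 60000 * X * Real.log X * (2 / (v + 1)) := by
        rw [← Finset.mul_sum]
        gcongr
        exact sum_Ioo_inv_sq_le _ _
    _ ≤ 60000 * X * Real.log X * (2 / V ^ ((1 : ℝ) / 6)) := by
        gcongr
        exact (Nat.lt_floor_add_one _).le
    _ = _ := by
        rw [hVr]
        ring

/-- The sign character modulo `4` on odd integers. -/
def modFourSign (n : ℕ) : ℂ := if n % 4 = 3 then -1 else 1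

theorem norm_modFourSign (n : ℕ) : ‖modFourSign n‖ = 1 := by
  unfold modFourSign
  split_ifs <;> simp

theorem jacobiSym_eq_modFourSign_mul {m n : ℕ} (hm : Odd m) (hn : Odd n) :
    (jacobiSym (m : ℤ) n : ℂ) = (1 + modFourSign m + modFourSign n
      - modFourSign m * modFourSign n) / 2 * (jacobiSym (n : ℤ) m : ℂ) := by
  rw [← jacobiSym.quadratic_reciprocity_if (Nat.odd_iff.mp hm) (Nat.odd_iff.mp hn)]
  unfold modFourSign
  by_cases h1 : m % 4 = 3 <;> by_cases h2 : n % 4 = 3 <;>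
    simp only [h1, h2, and_self, and_true, and_false, if_true, if_false] <;>
    push_cast <;> ring

theorem norm_sum_hyperbola_long_le {X V : ℝ} (hX : 2 ≤ X) (hV : 1 ≤ V) {α β : ℕ → ℂ}
    (hα : ∀ m, ‖α m‖ ≤ 1) (hβ : ∀ n, ‖β n‖ ≤ 1) (hodd : ∀ n, β n ≠ 0 → Odd n)
    (hsupp : ∀ m, α m ≠ 0 → Odd m ∧ V < m ∧ (m : ℝ) ^ 2 ≤ X) :
    ‖∑ n ∈ Finset.Icc 1 ⌊X⌋₊, ∑ m ∈ Finset.Icc 1 ⌊X⌋₊,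
      if ((m * n : ℕ) : ℝ) ≤ X then α m * β n * (jacobiSym (m : ℤ) n : ℂ) else 0‖
      ≤ 240000 * X * Real.log X * V ^ (-(1 : ℝ) / 6) := by
  let D : (ℕ → ℂ) → (ℕ → ℂ) → ℂ := fun a b => ∑ n ∈ Finset.Icc 1 ⌊X⌋₊,
    ∑ m ∈ Finset.Icc 1 ⌊X⌋₊,
      if ((m * n : ℕ) : ℝ) ≤ X then a m * b n * (jacobiSym (m : ℤ) n : ℂ) else 0
  let c : ℕ → ℂ := modFourSign
  have hD : ∀ a b : ℕ → ℂ, (∀ m, ‖a m‖ = 1) → (∀ n, ‖b n‖ = 1) →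
      ‖D (fun n => b n * β n) (fun m => a m * α m)‖
        ≤ 120000 * X * Real.log X * V ^ (-(1 : ℝ) / 6) := by
    intro a b ha hb
    refine norm_sum_hyperbola_short_le hX hV (fun m => ?_) (fun n => ?_) fun n hn => ?_
    · rw [norm_mul, hb, one_mul]
      exact hβ m
    · rw [norm_mul, ha, one_mul]
      exact hα n
    · exact hsupp n (right_ne_zero_of_mul hn)
  have hsplit : ∑ n ∈ Finset.Icc 1 ⌊X⌋₊, ∑ m ∈ Finset.Icc 1 ⌊X⌋₊,
      (if ((m * n : ℕ) : ℝ) ≤ X then α m * β n * (jacobiSym (m : ℤ) n : ℂ) else 0)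
      = 1 / 2 * (D (fun n => 1 * β n) (fun m => 1 * α m) + D (fun n => 1 * β n) (fun m => c m * α m)
        + D (fun n => c n * β n) (fun m => 1 * α m)
        - D (fun n => c n * β n) (fun m => c m * α m)) := by
    rw [Finset.sum_comm]
    simp only [D, ← Finset.sum_add_distrib, ← Finset.sum_sub_distrib, Finset.mul_sum]
    refine Finset.sum_congr rfl fun m _ => Finset.sum_congr rfl fun n _ => ?_
    rw [mul_comm n m]
    split_ifs with h
    · by_cases hm : α m = 0
      · simp [hm]
      by_cases hn : β n = 0
      · simp [hn]
      rw [jacobiSym_eq_modFourSign_mul (hsupp m hm).1 (hodd n hn)]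
      simp only [c]
      ring
    · simp
  rw [hsplit]
  have h1 : ∀ n : ℕ, ‖(fun _ : ℕ => (1 : ℂ)) n‖ = 1 := fun _ => norm_one
  have hc : ∀ n, ‖c n‖ = 1 := norm_modFourSign
  have e1 := hD _ _ h1 h1
  have e2 := hD _ _ hc h1
  have e3 := hD _ _ h1 hc
  have e4 := hD _ _ hc hc
  rw [norm_mul]
  have h2 : ‖(1 / 2 : ℂ)‖ = 1 / 2 := by norm_num
  rw [h2]
  have t := (norm_sub_le _ _).trans (add_le_add_left (norm_add₃_le (a := D (fun n => 1 * β n)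
    (fun m => 1 * α m)) (b := D (fun n => 1 * β n) (fun m => c m * α m))
    (c := D (fun n => c n * β n) (fun m => 1 * α m))) ‖D (fun n => c n * β n) (fun m => c m * α m)‖)
  linarith

/-- For sequences `α, β` supported on odd integers with modulus at most 1,
`∑∑_{m,n > V, mn ≤ X} α_m β_n (m|n) ≪ X V^{-1/6} (log X)^{7/6}` with an absolute
implied constant, where `(m|n)` is the Jacobi symbol. -/
theorem stmt_7 :
    ∃ C : ℝ, 0 < C ∧ ∀ (α β : ℕ → ℂ),
      (∀ m, Even m → α m = 0) → (∀ n, Even n → β n = 0) →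
      (∀ m, ‖α m‖ ≤ 1) → (∀ n, ‖β n‖ ≤ 1) →
      ∀ X V : ℝ, 2 ≤ X → 1 ≤ V →
      ‖∑ p ∈ (Finset.Icc 1 ⌊X⌋₊ ×ˢ Finset.Icc 1 ⌊X⌋₊).filter
            (fun p : ℕ × ℕ => V < (p.1 : ℝ) ∧ V < (p.2 : ℝ) ∧ ((p.1 * p.2 : ℕ) : ℝ) ≤ X),
          α p.1 * β p.2 * (jacobiSym (p.1 : ℤ) p.2 : ℂ)‖
        ≤ C * X * V ^ (-(1 : ℝ) / 6) * Real.log X ^ ((7 : ℝ) / 6) := by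
  classical
  refine ⟨720000, by norm_num, fun α β hα0 hβ0 hα hβ X V hX hV => ?_⟩
  have hX0 : 0 < X := by linarith
  have hV0 : 0 < V := by linarith
  let α' : ℕ → ℂ := fun m => if V < m then α m else 0
  let α₂ : ℕ → ℂ := fun m => if V < m ∧ (m : ℝ) ^ 2 ≤ X then α m else 0
  let β₁ : ℕ → ℂ := fun n => if V < n ∧ (n : ℝ) ^ 2 ≤ X then β n else 0
  let β₂ : ℕ → ℂ := fun n => if V < n ∧ ¬ (n : ℝ) ^ 2 ≤ X then β n else 0
  have hite : ∀ (P : Prop) [Decidable P] (z : ℂ), ‖z‖ ≤ 1 → ‖if P then z else 0‖ ≤ 1 := by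
    intro P _ z hz
    split_ifs
    · exact hz
    · simp
  have hαodd : ∀ m, α m ≠ 0 → Odd m := fun m h =>
    Nat.not_even_iff_odd.mp fun he => h (hα0 m he)
  have hβodd : ∀ n, β n ≠ 0 → Odd n := fun n h =>
    Nat.not_even_iff_odd.mp fun he => h (hβ0 n he)
  have hshort := norm_sum_hyperbola_short_le hX hV (α := α') (β := β₁)
    (fun m => hite _ _ (hα m)) (fun n => hite _ _ (hβ n)) (fun n hn => by
      obtain ⟨h1, h2⟩ := ite_ne_right_iff.mp hn
      exact ⟨hβodd n h2, h1⟩)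
  have hlong := norm_sum_hyperbola_long_le hX hV (α := α₂) (β := β₂)
    (fun m => hite _ _ (hα m)) (fun n => hite _ _ (hβ n))
    (fun n hn => hβodd n (ite_ne_right_iff.mp hn).2) (fun m hm => by
      obtain ⟨h1, h2⟩ := ite_ne_right_iff.mp hm
      exact ⟨hαodd m h2, h1⟩)
  have hsplit : ∑ p ∈ (Finset.Icc 1 ⌊X⌋₊ ×ˢ Finset.Icc 1 ⌊X⌋₊).filter
        (fun p : ℕ × ℕ => V < (p.1 : ℝ) ∧ V < (p.2 : ℝ) ∧ ((p.1 * p.2 : ℕ) : ℝ) ≤ X),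
        α p.1 * β p.2 * (jacobiSym (p.1 : ℤ) p.2 : ℂ)
      = (∑ n ∈ Finset.Icc 1 ⌊X⌋₊, ∑ m ∈ Finset.Icc 1 ⌊X⌋₊,
          if ((m * n : ℕ) : ℝ) ≤ X then α' m * β₁ n * (jacobiSym (m : ℤ) n : ℂ) else 0)
        + ∑ n ∈ Finset.Icc 1 ⌊X⌋₊, ∑ m ∈ Finset.Icc 1 ⌊X⌋₊,
          if ((m * n : ℕ) : ℝ) ≤ X then α₂ m * β₂ n * (jacobiSym (m : ℤ) n : ℂ) else 0 := by
    rw [Finset.sum_filter, Finset.sum_product_right, ← Finset.sum_add_distrib]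
    refine Finset.sum_congr rfl fun n _ => ?_
    rw [← Finset.sum_add_distrib]
    refine Finset.sum_congr rfl fun m _ => ?_
    by_cases hmn : ((m * n : ℕ) : ℝ) ≤ X
    swap
    · simp only [hmn, and_false, if_false, add_zero]
    by_cases hn : V < (n : ℝ)
    swap
    · simp [β₁, β₂, hn]
    by_cases hm : V < (m : ℝ)
    swap
    · simp [α', α₂, hm]
    by_cases hnX : (n : ℝ) ^ 2 ≤ X
    · simp only [α', α₂, β₁, β₂, hm, hn, hmn, hnX, and_self, not_true_eq_false, and_false,
        if_true, if_false, mul_zero, zero_mul, add_zero]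
    · have hmX : (m : ℝ) ^ 2 ≤ X := by
        have h1 : (m : ℝ) * n ≤ X := by exact_mod_cast hmn
        by_contra h
        push Not at h hnX
        have : X * X < (m : ℝ) ^ 2 * (n : ℝ) ^ 2 := mul_lt_mul'' h hnX hX0.le hX0.le
        have h2 : ((m : ℝ) * n) ^ 2 ≤ X ^ 2 := by gcongr
        nlinarith
      simp only [α', α₂, β₁, β₂, hm, hn, hmn, hnX, hmX, and_self, not_false_eq_true, and_false,
        if_true, if_false, mul_zero, zero_mul, zero_add]
  have hL : 1 / 2 ≤ Real.log X := by
    have h1 := Real.log_le_log two_pos hX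
    linarith [Real.log_two_gt_d9]
  have hL0 : 0 < Real.log X := by linarith
  have hlog : Real.log X ≤ 2 * Real.log X ^ ((7 : ℝ) / 6) := by
    have h1 : Real.log X ^ ((7 : ℝ) / 6) = Real.log X * Real.log X ^ ((1 : ℝ) / 6) := by
      rw [← Real.rpow_one_add' hL0.le (by norm_num)]
      norm_num
    have h2 : 1 / 2 ≤ Real.log X ^ ((1 : ℝ) / 6) := by
      calc (1 / 2 : ℝ) = (1 / 2 : ℝ) ^ (1 : ℝ) := (Real.rpow_one _).symm
        _ ≤ (1 / 2 : ℝ) ^ ((1 : ℝ) / 6) :=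
          Real.rpow_le_rpow_of_exponent_ge (by norm_num) (by norm_num) (by norm_num)
        _ ≤ _ := Real.rpow_le_rpow (by norm_num) hL (by norm_num)
    rw [h1]
    nlinarith
  rw [hsplit]
  have hVp : 0 ≤ V ^ (-(1 : ℝ) / 6) := Real.rpow_nonneg hV0.le _
  calc _ ≤ 120000 * X * Real.log X * V ^ (-(1 : ℝ) / 6)
        + 240000 * X * Real.log X * V ^ (-(1 : ℝ) / 6) :=
        (norm_add_le _ _).trans (add_le_add hshort hlong)
    _ = 360000 * X * V ^ (-(1 : ℝ) / 6) * Real.log X := by ring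
    _ ≤ 360000 * X * V ^ (-(1 : ℝ) / 6) * (2 * Real.log X ^ ((7 : ℝ) / 6)) := by gcongr
    _ = _ := by ring
end
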